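/- arXiv:2512.23285 — 2 statements merged into one kernel-verified Lean document; each statement's English description precedes it below -/
import Mathlib

section
/- The family of functions g_Q^{m,i}, indexed by all triples (m, Q, i) with 0 ≤ m ≤ ⌊n/2⌋, Q a standard Young tableau of shape (n−m,m), and 0 ≤ i ≤ n−2m, is pairwise orthogonal with respect to ⟨·,·⟩_π, each g_Q^{m,i} is nonzero, and for the column reading tableau T the norm is ⟨g_T^{m,i}, g_T^{m,i}⟩_π = (2^m/(n+1)) · C(n−2m,i)/C(n,m+i). -/
open Finset

attribute [local instance] Classical.propDecidable

/-- Stationary distribution of the binary Burnside process. -/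
noncomputable def piDist (n : ℕ) (U : Finset ℕ) : ℝ :=
  1 / ((n + 1) * (n.choose U.card))

/-- Binary Burnside transition matrix entry. -/
noncomputable def Kmat (n : ℕ) (x y : Finset ℕ) : ℝ :=
  (((2 * (n - (x ∪ y).card)).choose (n - (x ∪ y).card) : ℝ) *
      ((2 * ((y \ x).card)).choose ((y \ x).card)) *
      ((2 * ((x \ y).card)).choose ((x \ y).card)) *
      ((2 * ((x ∩ y).card)).choose ((x ∩ y).card))) /
    (4 ^ n * (((n - (x ∪ y).card) + (y \ x).card).choose (n - (x ∪ y).card)) *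
      (((x \ y).card + (x ∩ y).card).choose ((x \ y).card)))

/-- Action of K_n on functions. -/
noncomputable def Kop (n : ℕ) (f : Finset ℕ → ℝ) : Finset ℕ → ℝ :=
  fun x => ∑ y ∈ (Finset.Icc 1 n).powerset, Kmat n x y * f y

/-- s-step transition probabilities. -/
noncomputable def Kpow (n : ℕ) : ℕ → Finset ℕ → Finset ℕ → ℝ
  | 0 => fun x y => if x = y then 1 else 0
  | s + 1 => fun x y => ∑ z ∈ (Finset.Icc 1 n).powerset, Kmat n x z * Kpow n s z y

/-- Chi-square distance to stationarity after s steps, started at x. -/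
noncomputable def chiSq (n s : ℕ) (x : Finset ℕ) : ℝ :=
  ∑ y ∈ (Finset.Icc 1 n).powerset, (Kpow n s x y - piDist n y) ^ 2 / piDist n y

/-- Eigenvalues. -/
noncomputable def betaEV (k : ℕ) : ℝ := (((2 * k).choose k : ℝ)) ^ 2 / 16 ^ k

/-- The eigenvectors f_S of Diaconis–Lin–Ram. -/
noncomputable def fSvec (S : Finset ℕ) : Finset ℕ → ℝ :=
  fun U => (-1 : ℝ) ^ ((S ∩ U).card) * (S.card.choose ((S ∩ U).card))

/-- Inner product with respect to π. -/
noncomputable def innerPi (n : ℕ) (f g : Finset ℕ → ℝ) : ℝ :=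
  ∑ U ∈ (Finset.Icc 1 n).powerset, f U * g U * piDist n U

/-- The scalars T_{m,n}^{(ℓ)}(i). -/
noncomputable def Tcoef (n m ℓ i : ℕ) : ℝ :=
  ∑ j ∈ Finset.range (i + 1),
    if j ≤ ℓ then
      (-1 : ℝ) ^ (m + j) * ((2 * m + ℓ).choose (m + j)) * (i.choose j) *
        ((n - 2 * m - i).choose (ℓ - j))
    else 0

/-- The vector g_T^{m,i} associated to the column reading tableau. -/
noncomputable def gT (n m i : ℕ) : Finset ℕ → ℝ := fun U =>
  if (∀ r ∈ Finset.Icc 1 m, ((2 * r - 1 ∈ U) ↔ ¬(2 * r ∈ U))) ∧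
      (U ∩ Finset.Icc (2 * m + 1) n).card = i then
    (-1 : ℝ) ^ ((U ∩ (Finset.range m).image (fun r => 2 * r + 1)).card)
  else 0

/-- The vector f_T^{m,ℓ} associated to the column reading tableau. -/
noncomputable def fT (n m ℓ : ℕ) : Finset ℕ → ℝ :=
  fun U => ∑ i ∈ Finset.range (n - 2 * m + 1), Tcoef n m ℓ i * gT n m i U

/-- Action of the adjacent transposition s_t (switching t and t+1) on functions. -/
noncomputable def sOp (t : ℕ) (f : Finset ℕ → ℝ) : Finset ℕ → ℝ :=
  fun U => f (U.image (Equiv.swap t (t + 1)))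

/-- The factor s_t − 1/(t − 2r + 2) (r is the 1-indexed position in the second row). -/
noncomputable def tauFactor (r t : ℕ) (f : Finset ℕ → ℝ) : Finset ℕ → ℝ :=
  fun U => sOp t f U - ((t : ℝ) - 2 * r + 2)⁻¹ * f U

/-- Composition (s_{2r+k-1} − ⋯)⋯(s_{2r} − 1/2) of k successive factors. -/
noncomputable def tauComp (r : ℕ) : ℕ → (Finset ℕ → ℝ) → (Finset ℕ → ℝ)
  | 0 => id
  | k + 1 => fun f => tauFactor r (2 * r + k) (tauComp r k f)

/-- τ_Q^{(r)} τ_Q^{(r+1)} ⋯ for the remaining second-row entries. -/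
noncomputable def tauQAux : ℕ → List ℕ → (Finset ℕ → ℝ) → (Finset ℕ → ℝ)
  | _, [] => id
  | r, a :: rest => fun f => tauComp r (a - 2 * r) (tauQAux (r + 1) rest f)

/-- The operator τ_Q for a tableau Q encoded by its list of second-row entries. -/
noncomputable def tauQ (Q : List ℕ) : (Finset ℕ → ℝ) → (Finset ℕ → ℝ) := tauQAux 1 Q

/-- A standard Young tableau of shape (n − Q.length, Q.length), encoded by the strictly
increasing list of second-row entries, each entry a_r satisfying 2r ≤ a_r ≤ n. -/
def IsSYT (n : ℕ) (Q : List ℕ) : Prop :=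
  Q.Chain' (· < ·) ∧ (∀ x ∈ Q, x ≤ n) ∧ ∀ r < Q.length, 2 * (r + 1) ≤ Q.getD r 0

/-- The eigenvectors f_Q^{m,ℓ} (here m = Q.length). -/
noncomputable def fQvec (n : ℕ) (Q : List ℕ) (ℓ : ℕ) : Finset ℕ → ℝ :=
  tauQ Q (fT n Q.length ℓ)

/-- The orthogonal vectors g_Q^{m,i} (here m = Q.length). -/
noncomputable def gQvec (n : ℕ) (Q : List ℕ) (i : ℕ) : Finset ℕ → ℝ :=
  tauQ Q (gT n Q.length i)

/-- The constant γ_Q. -/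
noncomputable def gammaQ (Q : List ℕ) : ℝ :=
  ∏ r ∈ Finset.range Q.length, ∏ c ∈ Finset.Icc 2 (Q.getD r 0 - 2 * (r + 1) + 1),
    ((c : ℝ) ^ 2 - 1) / (c : ℝ) ^ 2

/-- The Murphy (Jucys–Murphy) operator M_r acting on functions. -/
noncomputable def murphy (r : ℕ) (f : Finset ℕ → ℝ) : Finset ℕ → ℝ :=
  fun U => ∑ i ∈ Finset.Icc 1 (r - 1), f (U.image (Equiv.swap i r))

/-- The state space as a finite type. -/
noncomputable def transpEndo (n a b : ℕ) :
    Module.End ℝ ((↥((Finset.Icc 1 n).powerset)) → ℝ) where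
  toFun f U := f (if h : U.1.image (Equiv.swap a b) ∈ (Finset.Icc 1 n).powerset
    then ⟨U.1.image (Equiv.swap a b), h⟩ else U)
  map_add' f g := rfl
  map_smul' c f := rfl

noncomputable def murphyEndo (n r : ℕ) :
    Module.End ℝ ((↥((Finset.Icc 1 n).powerset)) → ℝ) :=
  ∑ i ∈ Finset.Icc 1 (r - 1), transpEndo n i r

noncomputable def KEndo (n : ℕ) :
    Module.End ℝ ((↥((Finset.Icc 1 n).powerset)) → ℝ) where
  toFun f x := ∑ y : ↥((Finset.Icc 1 n).powerset), Kmat n x.1 y.1 * f y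
  map_add' f g := by funext x; simp [mul_add, Finset.sum_add_distrib]
  map_smul' c f := by funext x; simp [Finset.mul_sum, mul_left_comm]

/-- Membership in the image of a set under a transposition. -/
theorem mem_image_swap (a b x : ℕ) (U : Finset ℕ) :
    x ∈ U.image (Equiv.swap a b) ↔ Equiv.swap a b x ∈ U := by
  constructor
  · intro h
    obtain ⟨y, hy, rfl⟩ := Finset.mem_image.1 h
    simpa using hy
  · intro h
    exact Finset.mem_image.2 ⟨_, h, by simp⟩

theorem image_swap_image_swap (a b : ℕ) (U : Finset ℕ) :
    (U.image (Equiv.swap a b)).image (Equiv.swap a b) = U := by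
  ext x; simp only [mem_image_swap, Equiv.swap_apply_self]

theorem image_swap_comm (σ : Equiv.Perm ℕ) (i k : ℕ) (U : Finset ℕ) :
    (U.image (Equiv.swap i k)).image σ = (U.image σ).image (Equiv.swap (σ i) (σ k)) := by
  rw [Finset.image_image, Finset.image_image, ← Equiv.Perm.coe_mul, Equiv.mul_swap_eq_swap_mul,
    Equiv.Perm.coe_mul]

theorem image_swap_eq_self {a b : ℕ} {U : Finset ℕ} (h : a ∈ U ↔ b ∈ U) :
    U.image (Equiv.swap a b) = U := by
  ext x
  rw [mem_image_swap, Equiv.swap_apply_def]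
  split_ifs with h1 h2
  · rw [h1, h]
  · rw [h2, h]
  · rfl

theorem card_image_swap (a b : ℕ) (U : Finset ℕ) :
    (U.image (Equiv.swap a b)).card = U.card :=
  Finset.card_image_of_injective _ (Equiv.injective _)

theorem image_swap_subset_Icc {n a b : ℕ} (ha : a ∈ Icc 1 n) (hb : b ∈ Icc 1 n)
    {U : Finset ℕ} (hU : U ⊆ Icc 1 n) : U.image (Equiv.swap a b) ⊆ Icc 1 n := by
  intro x hx
  rw [mem_image_swap, Equiv.swap_apply_def] at hx
  split_ifs at hx with h1 h2
  · rwa [h1]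
  · rwa [h2]
  · exact hU hx

/-- A function antisymmetric in `a, b` is killed by antisymmetrisation over `a, b, z`. -/
theorem add_swap_eq_self {f : Finset ℕ → ℝ} {a b z : ℕ}
    (hf : ∀ U, f (U.image (Equiv.swap a b)) = -f U) (hab : a ≠ b) (haz : a ≠ z) (hbz : b ≠ z)
    (U : Finset ℕ) :
    f (U.image (Equiv.swap a z)) + f (U.image (Equiv.swap b z)) = f U := by
  have hzero : ∀ V : Finset ℕ, (a ∈ V ↔ b ∈ V) → f V = 0 := by
    intro V hV
    have h := hf V
    rw [image_swap_eq_self hV] at h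
    linarith
  by_cases h1 : a ∈ U ↔ z ∈ U
  · rw [image_swap_eq_self h1, hzero (U.image (Equiv.swap b z)), add_zero]
    rw [mem_image_swap, mem_image_swap, Equiv.swap_apply_left,
      Equiv.swap_apply_of_ne_of_ne hab haz, h1]
  by_cases h2 : b ∈ U ↔ z ∈ U
  · rw [image_swap_eq_self h2, hzero (U.image (Equiv.swap a z)), zero_add]
    rw [mem_image_swap, mem_image_swap, Equiv.swap_apply_left,
      Equiv.swap_apply_of_ne_of_ne hab.symm hbz, h2]
  have h3 : a ∈ U ↔ b ∈ U := by tauto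
  have h := hf (U.image (Equiv.swap a z))
  rw [image_swap_comm, image_swap_eq_self h3, Equiv.swap_apply_left,
    Equiv.swap_apply_of_ne_of_ne haz.symm hbz.symm] at h
  rw [h, hzero U h3]
  ring

section InnerProduct

theorem innerPi_swap_left {n a b : ℕ} (ha : a ∈ Icc 1 n) (hb : b ∈ Icc 1 n)
    (f g : Finset ℕ → ℝ) :
    innerPi n (fun U => f (U.image (Equiv.swap a b))) g =
      innerPi n f (fun U => g (U.image (Equiv.swap a b))) := by
  unfold innerPi
  refine Finset.sum_nbij' (fun U => U.image (Equiv.swap a b)) (fun U => U.image (Equiv.swap a b))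
    ?_ ?_ ?_ ?_ ?_
  · intro U hU
    exact mem_powerset.2 (image_swap_subset_Icc ha hb (mem_powerset.1 hU))
  · intro U hU
    exact mem_powerset.2 (image_swap_subset_Icc ha hb (mem_powerset.1 hU))
  · intro U _
    exact image_swap_image_swap a b U
  · intro U _
    exact image_swap_image_swap a b U
  · intro U _
    simp only [image_swap_image_swap, piDist, card_image_swap]

theorem innerPi_murphy_left {n k : ℕ} (hk : k ≤ n) (f g : Finset ℕ → ℝ) :
    innerPi n (murphy k f) g = innerPi n f (murphy k g) := by
  have h : ∀ i ∈ Icc 1 (k - 1), innerPi n (fun U => f (U.image (Equiv.swap i k))) g =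
      innerPi n f (fun U => g (U.image (Equiv.swap i k))) := by
    intro i hi
    rw [mem_Icc] at hi
    exact innerPi_swap_left (mem_Icc.2 (by omega)) (mem_Icc.2 (by omega)) f g
  have h' := Finset.sum_congr rfl h
  unfold innerPi at h' ⊢
  rw [Finset.sum_comm, Finset.sum_comm (s := Icc 1 (k - 1))] at h'
  simpa only [murphy, Finset.sum_mul, Finset.mul_sum] using h'

/-- Joint eigenfunctions of the Murphy operators `M_1, …, M_n` with eigenvalues `c`. -/
def IsMurphyEigen (n : ℕ) (f : Finset ℕ → ℝ) (c : ℕ → ℝ) : Prop :=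
  ∀ k ∈ Icc 1 n, ∀ U, murphy k f U = c k * f U

theorem IsMurphyEigen.innerPi_eq_zero {n : ℕ} {f g : Finset ℕ → ℝ} {c d : ℕ → ℝ}
    (hf : IsMurphyEigen n f c) (hg : IsMurphyEigen n g d) {k : ℕ} (hk : k ∈ Icc 1 n)
    (hcd : c k ≠ d k) : innerPi n f g = 0 := by
  have h := innerPi_murphy_left (mem_Icc.1 hk).2 f g
  have h1 : innerPi n (murphy k f) g = c k * innerPi n f g := by
    simp only [innerPi, hf k hk, Finset.mul_sum, mul_assoc]
  have h2 : innerPi n f (murphy k g) = d k * innerPi n f g := by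
    simp only [innerPi, hg k hk, Finset.mul_sum]
    exact Finset.sum_congr rfl fun U _ => by ring
  rw [h1, h2] at h
  have h3 : (c k - d k) * innerPi n f g = 0 := by linarith
  exact (mul_eq_zero.1 h3).resolve_left (sub_ne_zero.2 hcd)

end InnerProduct

section MurphyRelations

theorem murphy_sOp (k t : ℕ) (f : Finset ℕ → ℝ) (U : Finset ℕ) :
    murphy k (sOp t f) U = ∑ i ∈ Icc 1 (k - 1), f ((U.image (Equiv.swap t (t + 1))).image
      (Equiv.swap (Equiv.swap t (t + 1) i) (Equiv.swap t (t + 1) k))) := by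
  unfold murphy sOp
  exact Finset.sum_congr rfl fun i _ => by rw [image_swap_comm]

theorem murphy_sOp_of_ne {k t : ℕ} (ht : 1 ≤ t) (h1 : k ≠ t) (h2 : k ≠ t + 1)
    (f : Finset ℕ → ℝ) (U : Finset ℕ) :
    murphy k (sOp t f) U = murphy k f (U.image (Equiv.swap t (t + 1))) := by
  rw [murphy_sOp, Equiv.swap_apply_of_ne_of_ne h1 h2]
  refine Finset.sum_equiv (Equiv.swap t (t + 1)) ?_ fun i _ => rfl
  intro i
  rw [Equiv.swap_apply_def]
  split_ifs <;> simp only [mem_Icc] <;> omega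

theorem murphy_succ_eq {t : ℕ} (ht : 1 ≤ t) (f : Finset ℕ → ℝ) (U : Finset ℕ) :
    murphy (t + 1) f U = ∑ i ∈ Icc 1 (t - 1), f (U.image (Equiv.swap i (t + 1))) +
      f (U.image (Equiv.swap t (t + 1))) := by
  obtain ⟨s, rfl⟩ : ∃ s, t = s + 1 := ⟨t - 1, by omega⟩
  simp only [murphy, Nat.add_sub_cancel]
  rw [Finset.sum_Icc_succ_top (by omega)]

theorem murphy_self_sOp {t : ℕ} (ht : 1 ≤ t) (f : Finset ℕ → ℝ) (U : Finset ℕ) :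
    murphy t (sOp t f) U = murphy (t + 1) f (U.image (Equiv.swap t (t + 1))) - f U := by
  rw [murphy_sOp, murphy_succ_eq ht, image_swap_image_swap, add_sub_cancel_right,
    Equiv.swap_apply_left]
  refine Finset.sum_congr rfl fun i hi => ?_
  rw [mem_Icc] at hi
  rw [Equiv.swap_apply_of_ne_of_ne (by omega) (by omega)]

theorem murphy_succ_sOp {t : ℕ} (ht : 1 ≤ t) (f : Finset ℕ → ℝ) (U : Finset ℕ) :
    murphy (t + 1) (sOp t f) U = murphy t f (U.image (Equiv.swap t (t + 1))) + f U := by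
  rw [murphy_succ_eq ht]
  congr 1
  · refine Finset.sum_congr rfl fun i hi => ?_
    rw [mem_Icc] at hi
    rw [sOp, image_swap_comm, Equiv.swap_apply_right,
      Equiv.swap_apply_of_ne_of_ne (by omega) (by omega)]
  · rw [sOp, image_swap_image_swap]

theorem murphy_tauFactor (k r t : ℕ) (f : Finset ℕ → ℝ) (U : Finset ℕ) :
    murphy k (tauFactor r t f) U =
      murphy k (sOp t f) U - ((t : ℝ) - 2 * r + 2)⁻¹ * murphy k f U := by
  simp only [murphy, tauFactor, Finset.sum_sub_distrib, Finset.mul_sum]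

theorem IsMurphyEigen.tauFactor {n r t : ℕ} {f : Finset ℕ → ℝ} {c : ℕ → ℝ}
    (hf : IsMurphyEigen n f c) (ht : 1 ≤ t) (htn : t + 1 ≤ n)
    (hd : c (t + 1) - c t = (t : ℝ) - 2 * r + 2) (hne : (t : ℝ) - 2 * r + 2 ≠ 0) :
    IsMurphyEigen n (tauFactor r t f) (fun k => c (Equiv.swap t (t + 1) k)) := by
  have hα := hf t (mem_Icc.2 (by omega))
  have hβ := hf (t + 1) (mem_Icc.2 (by omega))
  intro k hk U
  rw [murphy_tauFactor]
  simp only [_root_.tauFactor]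
  rw [← hd] at hne ⊢
  by_cases h1 : k = t
  · subst h1
    rw [murphy_self_sOp ht, hα, hβ, Equiv.swap_apply_left, sOp]
    field_simp
    ring
  by_cases h2 : k = t + 1
  · subst h2
    rw [murphy_succ_sOp ht, hα, hβ, Equiv.swap_apply_right, sOp]
    field_simp
    ring
  · rw [murphy_sOp_of_ne ht h1 h2, hf k hk, hf k hk, Equiv.swap_apply_of_ne_of_ne h1 h2, sOp]
    ring

end MurphyRelations

section Content

/-- The content of the box containing `k` in the two-row tableau with second-row entries `A`. -/
noncomputable def content (A : Finset ℕ) (k : ℕ) : ℝ :=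
  if k ∈ A then ((A.filter (· ≤ k)).card : ℝ) - 2 else (k : ℝ) - (A.filter (· ≤ k)).card - 1

theorem content_exchange {B : Finset ℕ} {t : ℕ} (h1 : t ∉ B) (h2 : t + 1 ∉ B) (k : ℕ) :
    content (insert t B) (Equiv.swap t (t + 1) k) = content (insert (t + 1) B) k := by
  have hlt : (insert t B).filter (· ≤ t) = insert t (B.filter (· ≤ t)) := by
    ext x; simp only [mem_filter, mem_insert]; grind
  have hlt' : (insert t B).filter (· ≤ t + 1) = insert t (B.filter (· ≤ t)) := by
    ext x; simp only [mem_filter, mem_insert]; grind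
  have hrt : (insert (t + 1) B).filter (· ≤ t) = B.filter (· ≤ t) := by
    ext x; simp only [mem_filter, mem_insert]; grind
  have hrt' : (insert (t + 1) B).filter (· ≤ t + 1) = insert (t + 1) (B.filter (· ≤ t)) := by
    ext x; simp only [mem_filter, mem_insert]; grind
  have hc : (insert t (B.filter (· ≤ t))).card = (B.filter (· ≤ t)).card + 1 :=
    card_insert_of_notMem (by simp [h1])
  have hc' : (insert (t + 1) (B.filter (· ≤ t))).card = (B.filter (· ≤ t)).card + 1 :=
    card_insert_of_notMem (by simp [h2])
  by_cases hk : k = t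
  · subst hk
    rw [Equiv.swap_apply_left, content, content, if_neg (by simp [h2]), if_neg (by simp [h1]),
      hlt', hrt, hc]
    push_cast; ring
  by_cases hk' : k = t + 1
  · subst hk'
    rw [Equiv.swap_apply_right, content, content, if_pos (by simp), if_pos (by simp),
      hlt, hrt', hc, hc']
  rw [Equiv.swap_apply_of_ne_of_ne hk hk', content, content]
  have hm : k ∈ insert t B ↔ k ∈ insert (t + 1) B := by simp [hk, hk']
  have hcard : ((insert t B).filter (· ≤ k)).card = ((insert (t + 1) B).filter (· ≤ k)).card := by
    rcases lt_or_gt_of_ne hk with h | h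
    · congr 1
      ext x; simp only [mem_filter, mem_insert]; grind
    · rw [filter_insert, filter_insert, if_pos (by omega), if_pos (by omega),
        card_insert_of_notMem (by simp [h1]), card_insert_of_notMem (by simp [h2])]
  simp only [hm, hcard]

theorem content_succ_sub {B : Finset ℕ} {t : ℕ} (h1 : t ∉ B) (h2 : t + 1 ∉ B) :
    content (insert t B) (t + 1) - content (insert t B) t =
      (t : ℝ) - 2 * ((B.filter (· ≤ t)).card + 1 : ℕ) + 2 := by
  have hlt : (insert t B).filter (· ≤ t) = insert t (B.filter (· ≤ t)) := by
    ext x; simp only [mem_filter, mem_insert]; grind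
  have hlt' : (insert t B).filter (· ≤ t + 1) = insert t (B.filter (· ≤ t)) := by
    ext x; simp only [mem_filter, mem_insert]; grind
  have hc : (insert t (B.filter (· ≤ t))).card = (B.filter (· ≤ t)).card + 1 :=
    card_insert_of_notMem (by simp [h1])
  rw [content, content, if_neg (by simp [h2]), if_pos (by simp), hlt, hlt', hc]
  push_cast; ring

/-- The second-row entries `2, 4, …, 2m` of the column reading tableau. -/
noncomputable def evensUpTo (m : ℕ) : Finset ℕ := (Icc 1 m).image (2 * ·)

theorem mem_evensUpTo {m x : ℕ} : x ∈ evensUpTo m ↔ 1 ≤ x / 2 ∧ x / 2 ≤ m ∧ x % 2 = 0 := by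
  simp only [evensUpTo, mem_image, mem_Icc]
  constructor
  · rintro ⟨y, hy, rfl⟩; omega
  · intro h; exact ⟨x / 2, by omega, by omega⟩

theorem card_evensUpTo (m : ℕ) : (evensUpTo m).card = m := by
  rw [evensUpTo, card_image_of_injective _ (fun a b h => by simpa using h), Nat.card_Icc]
  omega

theorem card_filter_evensUpTo (m k : ℕ) :
    ((evensUpTo m).filter (· ≤ k)).card = min m (k / 2) := by
  rw [← card_evensUpTo (min m (k / 2))]
  congr 1
  ext x
  simp only [mem_filter, mem_evensUpTo]
  omega

theorem evensUpTo_succ (m : ℕ) : evensUpTo (m + 1) = insert (2 * (m + 1)) (evensUpTo m) := by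
  ext x
  simp only [mem_insert, mem_evensUpTo]
  omega

end Content

section ColumnReading

theorem gT_eq_prod (n m i : ℕ) (U : Finset ℕ) :
    gT n m i U = (∏ r ∈ range m, ((if 2 * r + 2 ∈ U then (1 : ℝ) else 0) -
      (if 2 * r + 1 ∈ U then 1 else 0))) *
      (if (U ∩ Icc (2 * m + 1) n).card = i then 1 else 0) := by
  unfold gT
  by_cases hc : (U ∩ Icc (2 * m + 1) n).card = i
  swap
  · rw [if_neg (fun h => hc h.2), if_neg hc, mul_zero]
  rw [if_pos hc, mul_one]
  by_cases h : ∀ r ∈ Icc 1 m, (2 * r - 1 ∈ U ↔ ¬ 2 * r ∈ U)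
  · rw [if_pos ⟨h, hc⟩]
    have hcard : (U ∩ (range m).image (fun r => 2 * r + 1)).card =
        ((range m).filter (fun r => 2 * r + 1 ∈ U)).card := by
      rw [← card_image_of_injective ((range m).filter (fun r => 2 * r + 1 ∈ U))
        (f := fun r => 2 * r + 1) (fun a b hab => by simpa using hab)]
      congr 1
      ext x
      simp only [mem_inter, mem_image, mem_filter]
      constructor
      · rintro ⟨hx, r, hr, rfl⟩; exact ⟨r, ⟨hr, hx⟩, rfl⟩
      · rintro ⟨r, ⟨hr, hx⟩, rfl⟩; exact ⟨hx, r, hr, rfl⟩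
    rw [hcard, ← Finset.prod_const, Finset.prod_filter]
    refine Finset.prod_congr rfl fun r hr => ?_
    have hr' := h (r + 1) (mem_Icc.2 (by rw [mem_range] at hr; omega))
    rw [show 2 * (r + 1) - 1 = 2 * r + 1 by omega, show 2 * (r + 1) = 2 * r + 2 by omega] at hr'
    by_cases h1 : 2 * r + 1 ∈ U
    · simp [h1, hr'.1 h1]
    · have h2 : 2 * r + 2 ∈ U := by tauto
      simp [h1, h2]
  · rw [if_neg (fun h' => h h'.1)]
    push Not at h
    obtain ⟨r, hr, h⟩ := h
    rw [mem_Icc] at hr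
    symm
    refine Finset.prod_eq_zero (i := r - 1) (mem_range.2 (by omega)) ?_
    rw [show 2 * (r - 1) + 2 = 2 * r by omega, show 2 * (r - 1) + 1 = 2 * r - 1 by omega]
    have h' : 2 * r ∈ U ↔ 2 * r - 1 ∈ U := by tauto
    simp [h']

theorem gT_swap_pair {n m i p : ℕ} (hp : p < m) (U : Finset ℕ) :
    gT n m i (U.image (Equiv.swap (2 * p + 1) (2 * p + 2))) = -gT n m i U := by
  have htail : U.image (Equiv.swap (2 * p + 1) (2 * p + 2)) ∩ Icc (2 * m + 1) n =
      U ∩ Icc (2 * m + 1) n := by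
    ext x
    simp only [mem_inter, mem_image_swap, mem_Icc]
    refine and_congr_left fun hx => ?_
    rw [Equiv.swap_apply_of_ne_of_ne (by omega) (by omega)]
  rw [gT_eq_prod, gT_eq_prod, htail, ← neg_mul]
  congr 1
  rw [← Finset.mul_prod_erase _ _ (mem_range.2 hp), ← Finset.mul_prod_erase _ _ (mem_range.2 hp),
    ← neg_mul]
  congr 1
  · simp only [mem_image_swap, Equiv.swap_apply_left, Equiv.swap_apply_right, neg_sub]
  · refine Finset.prod_congr rfl fun r hr => ?_
    have hr' := (mem_erase.1 hr).1
    have h1 : Equiv.swap (2 * p + 1) (2 * p + 2) (2 * r + 1) = 2 * r + 1 :=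
      Equiv.swap_apply_of_ne_of_ne (by omega) (by omega)
    have h2 : Equiv.swap (2 * p + 1) (2 * p + 2) (2 * r + 2) = 2 * r + 2 :=
      Equiv.swap_apply_of_ne_of_ne (by omega) (by omega)
    simp only [mem_image_swap, h1, h2]

theorem gT_swap_tail {n m i a b : ℕ} (ha : a ∈ Icc (2 * m + 1) n) (hb : b ∈ Icc (2 * m + 1) n)
    (U : Finset ℕ) : gT n m i (U.image (Equiv.swap a b)) = gT n m i U := by
  have htail : U.image (Equiv.swap a b) ∩ Icc (2 * m + 1) n =
      (U ∩ Icc (2 * m + 1) n).image (Equiv.swap a b) := by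
    ext x
    simp only [mem_inter, mem_image_swap]
    refine and_congr_right fun _ => ?_
    rw [Equiv.swap_apply_def]
    split_ifs with h1 h2
    · simp only [h1, ha, hb]
    · simp only [h2, ha, hb]
    · rfl
  rw [mem_Icc] at ha hb
  rw [gT_eq_prod, gT_eq_prod, htail, card_image_swap]
  congr 1
  refine Finset.prod_congr rfl fun r hr => ?_
  rw [mem_range] at hr
  have h1 : Equiv.swap a b (2 * r + 1) = 2 * r + 1 :=
    Equiv.swap_apply_of_ne_of_ne (by omega) (by omega)
  have h2 : Equiv.swap a b (2 * r + 2) = 2 * r + 2 :=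
    Equiv.swap_apply_of_ne_of_ne (by omega) (by omega)
  simp only [mem_image_swap, h1, h2]

theorem sum_swap_pairs_gT {n m i p k : ℕ} (hp : p ≤ m) (hk : 2 * p < k) (U : Finset ℕ) :
    ∑ j ∈ Icc 1 (2 * p), gT n m i (U.image (Equiv.swap j k)) = p * gT n m i U := by
  induction p with
  | zero => simp
  | succ p ih =>
    rw [show 2 * (p + 1) = 2 * p + 1 + 1 by ring, Finset.sum_Icc_succ_top (by omega),
      Finset.sum_Icc_succ_top (by omega), ih (by omega) (by omega), add_assoc,
      add_swap_eq_self (gT_swap_pair (by omega)) (by omega) (by omega) (by omega)]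
    push_cast; ring

theorem sum_swap_tail_gT {n m i j k : ℕ} (hk : 2 * m + j < k) (hkn : k ≤ n) (U : Finset ℕ) :
    ∑ l ∈ Icc 1 (2 * m + j), gT n m i (U.image (Equiv.swap l k)) = (m + j) * gT n m i U := by
  induction j with
  | zero => simpa using sum_swap_pairs_gT le_rfl (by omega) U
  | succ j ih =>
    rw [← add_assoc, Finset.sum_Icc_succ_top (by omega), ih (by omega),
      gT_swap_tail (mem_Icc.2 (by omega)) (mem_Icc.2 (by omega))]
    push_cast; ring

theorem isMurphyEigen_gT (n m i : ℕ) :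
    IsMurphyEigen n (gT n m i) (content (evensUpTo m)) := by
  intro k hk U
  rw [mem_Icc] at hk
  rw [murphy, content, card_filter_evensUpTo]
  by_cases hkm : 2 * m < k
  · obtain ⟨j, rfl⟩ : ∃ j, k = 2 * m + j + 1 := ⟨k - 2 * m - 1, by omega⟩
    rw [Nat.add_sub_cancel, sum_swap_tail_gT (by omega) hk.2,
      if_neg (by rw [mem_evensUpTo]; omega), min_eq_left (by omega)]
    push_cast; ring
  rcases Nat.even_or_odd' k with ⟨p, rfl | rfl⟩
  · obtain ⟨q, rfl⟩ : ∃ q, p = q + 1 := ⟨p - 1, by omega⟩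
    rw [show 2 * (q + 1) - 1 = 2 * q + 1 by omega, Finset.sum_Icc_succ_top (by omega),
      sum_swap_pairs_gT (by omega) (by omega), show 2 * (q + 1) = 2 * q + 2 by ring,
      gT_swap_pair (by omega), if_pos (by rw [mem_evensUpTo]; omega),
      show min m ((2 * q + 2) / 2) = q + 1 by omega]
    push_cast; ring
  · rw [Nat.add_sub_cancel, sum_swap_pairs_gT (by omega) (by omega),
      if_neg (by rw [mem_evensUpTo]; omega), show min m ((2 * p + 1) / 2) = p by omega]
    push_cast; ring

end ColumnReading

section TauQ

theorem isMurphyEigen_tauComp {n r : ℕ} {f : Finset ℕ → ℝ} {B : Finset ℕ} (k : ℕ)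
    (hk : 2 * (r + 1) + k ≤ n)
    (hf : IsMurphyEigen n f (content (insert (2 * (r + 1)) (evensUpTo r ∪ B))))
    (hB : ∀ x ∈ B, 2 * (r + 1) + k < x) :
    IsMurphyEigen n (tauComp (r + 1) k f)
      (content (insert (2 * (r + 1) + k) (evensUpTo r ∪ B))) := by
  induction k with
  | zero => exact hf
  | succ k ih =>
    have hB' : ∀ x ∈ B, 2 * (r + 1) + k < x := fun x hx => by have := hB x hx; omega
    have h1 : 2 * (r + 1) + k ∉ evensUpTo r ∪ B := by
      rw [mem_union, mem_evensUpTo]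
      rintro (h | h)
      · omega
      · have := hB _ h; omega
    have h2 : 2 * (r + 1) + k + 1 ∉ evensUpTo r ∪ B := by
      rw [mem_union, mem_evensUpTo]
      rintro (h | h)
      · omega
      · have := hB _ h; omega
    have hcard : ((evensUpTo r ∪ B).filter (· ≤ 2 * (r + 1) + k)).card = r := by
      have : (evensUpTo r ∪ B).filter (· ≤ 2 * (r + 1) + k) = evensUpTo r := by
        ext x
        simp only [mem_filter, mem_union]
        constructor
        · rintro ⟨h | h, hx⟩
          · exact h
          · have := hB' x h; omega
        · intro h
          refine ⟨Or.inl h, ?_⟩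
          rw [mem_evensUpTo] at h; omega
      rw [this, card_evensUpTo]
    have hd := content_succ_sub h1 h2
    rw [hcard] at hd
    have := (ih (by omega) hB').tauFactor (by omega) (by omega) hd (by
      push_cast
      have : (0 : ℝ) ≤ k := k.cast_nonneg
      intro h; linarith)
    simp only [content_exchange h1 h2] at this
    exact this

theorem isMurphyEigen_tauQAux {n : ℕ} (f : Finset ℕ → ℝ) (Q : List ℕ) (r : ℕ)
    (hlt : Q.Pairwise (· < ·)) (hle : ∀ x ∈ Q, x ≤ n)
    (hst : ∀ (j : ℕ) (hj : j < Q.length), 2 * (r + j + 1) ≤ Q[j])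
    (hf : IsMurphyEigen n f (content (evensUpTo (r + Q.length)))) :
    IsMurphyEigen n (tauQAux (r + 1) Q f) (content (evensUpTo r ∪ Q.toFinset)) := by
  induction Q generalizing r with
  | nil => simpa [tauQAux] using hf
  | cons a Q ih =>
    rw [List.pairwise_cons] at hlt
    have ha : 2 * (r + 1) ≤ a := hst 0 (by simp)
    have han : a ≤ n := hle a (by simp)
    have h := ih (r + 1) hlt.2 (fun x hx => hle x (by simp [hx]))
      (fun j hj => by
        have := hst (j + 1) (by simpa using hj)
        simp only [List.getElem_cons_succ] at this
        omega)
      (by rw [List.length_cons] at hf; rwa [show r + 1 + Q.length = r + (Q.length + 1) by ring])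
    rw [evensUpTo_succ, insert_union] at h
    have key := isMurphyEigen_tauComp (a - 2 * (r + 1)) (by omega) h (fun x hx => by
      have := hlt.1 x (by simpa using hx)
      omega)
    rw [show 2 * (r + 1) + (a - 2 * (r + 1)) = a by omega] at key
    rw [List.toFinset_cons, union_insert]
    exact key

theorem IsSYT.pairwise {n : ℕ} {Q : List ℕ} (hQ : IsSYT n Q) : Q.Pairwise (· < ·) :=
  List.isChain_iff_pairwise.1 hQ.1

theorem IsSYT.le_getElem {n : ℕ} {Q : List ℕ} (hQ : IsSYT n Q) (j : ℕ) (hj : j < Q.length) :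
    2 * (j + 1) ≤ Q[j] := by
  have := hQ.2.2 j hj
  rwa [List.getD_eq_getElem _ _ hj] at this

theorem isMurphyEigen_gQvec {n : ℕ} {Q : List ℕ} (hQ : IsSYT n Q) (i : ℕ) :
    IsMurphyEigen n (gQvec n Q i) (content Q.toFinset) := by
  have h := isMurphyEigen_tauQAux (gT n Q.length i) Q 0 hQ.pairwise hQ.2.1
    (fun j hj => by simpa using hQ.le_getElem j hj) (by simpa using isMurphyEigen_gT n Q.length i)
  simpa [evensUpTo, gQvec, tauQ] using h

/-- Any property of functions preserved by the factors of `τ_Q` is preserved by `τ_Q`. -/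
theorem tauQAux_induction {n : ℕ} {P : (Finset ℕ → ℝ) → Prop}
    (hP : ∀ r t f, 1 ≤ r → 2 * r ≤ t → t + 1 ≤ n → P f → P (tauFactor r t f))
    (Q : List ℕ) (hle : ∀ x ∈ Q, x ≤ n) (r : ℕ) (hr : 1 ≤ r) {f : Finset ℕ → ℝ} (hf : P f) :
    P (tauQAux r Q f) := by
  induction Q generalizing r with
  | nil => exact hf
  | cons a Q ih =>
    have h := ih (fun x hx => hle x (by simp [hx])) (r + 1) (by omega)
    have hcomp : ∀ k g, k ≤ a - 2 * r → P g → P (tauComp r k g) := by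
      intro k g hk hg
      induction k with
      | zero => exact hg
      | succ k ihk =>
        have := hle a (by simp)
        exact hP _ _ _ hr (by omega) (by omega) (ihk (by omega))
    exact hcomp _ _ le_rfl h

end TauQ

section Distinct

theorem IsSYT.two_mul_card_filter_le {n : ℕ} {Q : List ℕ} (hQ : IsSYT n Q) {k : ℕ} (hk : k ∈ Q) :
    2 * (Q.toFinset.filter (· ≤ k)).card ≤ k := by
  obtain ⟨j, hj, rfl⟩ := List.mem_iff_getElem.1 hk
  refine le_trans ?_ (hQ.le_getElem j hj)
  have hsub : Q.toFinset.filter (· ≤ Q[j]) ⊆ (range (j + 1)).image (fun l => Q.getD l 0) := by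
    intro x hx
    rw [mem_filter, List.mem_toFinset] at hx
    obtain ⟨l, hl, rfl⟩ := List.mem_iff_getElem.1 hx.1
    refine mem_image.2 ⟨l, mem_range.2 ?_, List.getD_eq_getElem _ _ hl⟩
    by_contra hlj
    have := List.pairwise_iff_getElem.1 hQ.pairwise j l hj hl (by omega)
    omega
  have := (card_le_card hsub).trans card_image_le
  rw [card_range] at this
  omega

theorem IsSYT.content_ne_of_mem {n : ℕ} {Q₁ Q₂ : List ℕ} (h₁ : IsSYT n Q₁) {k : ℕ}
    (hk₁ : k ∈ Q₁) (hk₂ : k ∉ Q₂) (hmin : ∀ x < k, (x ∈ Q₁ ↔ x ∈ Q₂)) :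
    content Q₁.toFinset k ≠ content Q₂.toFinset k := by
  have hfil : Q₁.toFinset.filter (· ≤ k) = insert k (Q₂.toFinset.filter (· ≤ k)) := by
    ext x
    simp only [mem_filter, mem_insert, List.mem_toFinset]
    rcases lt_trichotomy x k with h | h | h
    · simp [hmin x h, h.ne]
    · simp [h, hk₁]
    · simp [h.ne', not_le.2 h]
  have hcard : (Q₁.toFinset.filter (· ≤ k)).card = (Q₂.toFinset.filter (· ≤ k)).card + 1 := by
    rw [hfil, card_insert_of_notMem (by simp [hk₂])]
  have hle := h₁.two_mul_card_filter_le hk₁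
  rw [content, content, if_pos (by simpa using hk₁), if_neg (by simpa using hk₂), hcard]
  rw [hcard] at hle
  have hle' : 2 * (((Q₂.toFinset.filter (· ≤ k)).card : ℝ) + 1) ≤ k := by exact_mod_cast hle
  push_cast
  intro h
  linarith

theorem IsSYT.exists_content_ne {n : ℕ} {Q₁ Q₂ : List ℕ} (h₁ : IsSYT n Q₁) (h₂ : IsSYT n Q₂)
    (hne : Q₁ ≠ Q₂) : ∃ k ∈ Icc 1 n, content Q₁.toFinset k ≠ content Q₂.toFinset k := by
  have hex : ∃ k, ¬ (k ∈ Q₁ ↔ k ∈ Q₂) := by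
    by_contra! h
    refine hne (List.Perm.eq_of_pairwise (fun a b _ _ hab hba => absurd hab hba.asymm)
      h₁.pairwise h₂.pairwise ?_)
    exact (List.perm_ext_iff_of_nodup (h₁.pairwise.imp fun h => h.ne)
      (h₂.pairwise.imp fun h => h.ne)).2 h
  have hmin : ∀ x < Nat.find hex, (x ∈ Q₁ ↔ x ∈ Q₂) := fun x hx =>
    not_not.1 (Nat.find_min hex hx)
  have hmem : ∀ {Q : List ℕ}, IsSYT n Q → ∀ {k}, k ∈ Q → k ∈ Icc 1 n := by
    intro Q hQ k hk
    refine mem_Icc.2 ⟨?_, hQ.2.1 k hk⟩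
    obtain ⟨j, hj, rfl⟩ := List.mem_iff_getElem.1 hk
    have := hQ.le_getElem j hj
    omega
  have hspec := Nat.find_spec hex
  by_cases hk : Nat.find hex ∈ Q₁
  · have hk₂ : Nat.find hex ∉ Q₂ := by tauto
    exact ⟨_, hmem h₁ hk, h₁.content_ne_of_mem hk hk₂ hmin⟩
  · have hk₂ : Nat.find hex ∈ Q₂ := by tauto
    exact ⟨_, hmem h₂ hk₂, (h₂.content_ne_of_mem hk₂ hk fun x hx => (hmin x hx).symm).symm⟩

end Distinct

section Norm

/-- The subsets of `{1, …, n}` on which `gT n m i` does not vanish. -/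
noncomputable def supportT (n m i : ℕ) : Finset (Finset ℕ) :=
  (Icc 1 n).powerset.filter fun U => (∀ r ∈ Icc 1 m, (2 * r - 1 ∈ U ↔ ¬ 2 * r ∈ U)) ∧
    (U ∩ Icc (2 * m + 1) n).card = i

theorem card_inter_pairs {m : ℕ} {U : Finset ℕ}
    (h : ∀ r ∈ Icc 1 m, (2 * r - 1 ∈ U ↔ ¬ 2 * r ∈ U)) : (U ∩ Icc 1 (2 * m)).card = m := by
  have : (U ∩ Icc 1 (2 * m)).card = (Icc 1 m).card := by
    refine card_nbij' (fun x => (x + 1) / 2) (fun r => if 2 * r ∈ U then 2 * r else 2 * r - 1)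
      ?_ ?_ ?_ ?_
    · intro x hx
      simp only [coe_inter, coe_Icc, Set.mem_inter_iff, Set.mem_Icc] at hx ⊢
      omega
    · intro r hr
      have hr' := h r hr
      simp only [coe_inter, coe_Icc, Set.mem_inter_iff, Set.mem_Icc, mem_coe] at hr ⊢
      split_ifs with h2
      · exact ⟨h2, by omega⟩
      · exact ⟨hr'.2 h2, by omega⟩
    · intro x hx
      simp only [coe_inter, coe_Icc, Set.mem_inter_iff, Set.mem_Icc, mem_coe] at hx
      have hx' := h ((x + 1) / 2) (mem_Icc.2 (by omega))
      rcases Nat.even_or_odd' x with ⟨p, rfl | rfl⟩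
      · have : 2 * ((2 * p + 1) / 2) = 2 * p := by omega
        simp only [this, hx.1, if_true]
      · have h1 : 2 * ((2 * p + 1 + 1) / 2) - 1 = 2 * p + 1 := by omega
        rw [h1] at hx'
        simp only [hx'.1 hx.1, if_false, h1]
    · intro r hr
      simp only [coe_Icc, Set.mem_Icc] at hr
      dsimp only
      split_ifs <;> omega
  rw [this, Nat.card_Icc]
  omega

theorem card_of_mem_supportT {n m i : ℕ} {U : Finset ℕ}
    (hU : U ∈ supportT n m i) : U.card = m + i := by
  rw [supportT, mem_filter, mem_powerset] at hU
  obtain ⟨hsub, hpairs, hi⟩ := hU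
  have hsplit : U = (U ∩ Icc 1 (2 * m)) ∪ (U ∩ Icc (2 * m + 1) n) := by
    ext x
    simp only [mem_union, mem_inter, mem_Icc]
    constructor
    · intro hx
      have := mem_Icc.1 (hsub hx)
      by_cases h : x ≤ 2 * m
      · exact Or.inl ⟨hx, by omega⟩
      · exact Or.inr ⟨hx, by omega⟩
    · rintro (h | h) <;> exact h.1
  rw [hsplit, card_union_of_disjoint, card_inter_pairs hpairs, hi]
  rw [disjoint_left]
  intro x hx hx'
  simp only [mem_inter, mem_Icc] at hx hx'
  omega

theorem card_supportT {n m i : ℕ} (hm : 2 * m ≤ n) :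
    (supportT n m i).card = 2 ^ m * (n - 2 * m).choose i := by
  have : (supportT n m i).card =
      ((Icc 1 m).powerset ×ˢ (Icc (2 * m + 1) n).powersetCard i).card := by
    refine card_nbij' (fun U => ((Icc 1 m).filter (fun r => 2 * r ∈ U), U ∩ Icc (2 * m + 1) n))
      (fun p => (Icc 1 (2 * m)).filter
        (fun x => if x % 2 = 0 then x / 2 ∈ p.1 else (x + 1) / 2 ∉ p.1) ∪ p.2) ?_ ?_ ?_ ?_
    · intro U hU
      rw [mem_coe, supportT, mem_filter] at hU
      rw [mem_coe, mem_product, mem_powerset, mem_powersetCard]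
      exact ⟨filter_subset _ _, inter_subset_right, hU.2.2⟩
    · rintro ⟨S, V⟩ h
      rw [mem_coe, mem_product, mem_powerset, mem_powersetCard] at h
      obtain ⟨hS, hV, hi⟩ := h
      dsimp only at hS hV hi ⊢
      have hV' : ∀ x ∈ V, 2 * m + 1 ≤ x ∧ x ≤ n := fun x hx => mem_Icc.1 (hV hx)
      rw [mem_coe, supportT, mem_filter, mem_powerset]
      refine ⟨?_, ?_, ?_⟩
      · intro x hx
        rw [mem_union, mem_filter, mem_Icc] at hx
        rw [mem_Icc]
        rcases hx with hx | hx
        · omega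
        · have := hV' x hx; omega
      · intro r hr
        rw [mem_Icc] at hr
        have h1 : 2 * r ∉ V := fun hx => by have := hV' _ hx; omega
        have h2 : 2 * r - 1 ∉ V := fun hx => by have := hV' _ hx; omega
        simp only [mem_union, mem_filter, mem_Icc, h1, h2, or_false]
        rw [if_neg (by omega), if_pos (by omega), show (2 * r - 1 + 1) / 2 = r by omega,
          show 2 * r / 2 = r by omega]
        have h3 : 1 ≤ 2 * r - 1 ∧ 2 * r - 1 ≤ 2 * m := by omega
        have h4 : 1 ≤ 2 * r ∧ 2 * r ≤ 2 * m := by omega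
        tauto
      · rw [← hi]
        congr 1
        ext x
        simp only [mem_inter, mem_union, mem_filter, mem_Icc]
        constructor
        · rintro ⟨h | h, h'⟩
          · omega
          · exact h
        · intro h; exact ⟨Or.inr h, hV' x h⟩
    · intro U hU
      rw [mem_coe, supportT, mem_filter, mem_powerset] at hU
      obtain ⟨hsub, hpairs, -⟩ := hU
      ext x
      simp only [mem_union, mem_filter, mem_inter, mem_Icc]
      by_cases hx : 1 ≤ x ∧ x ≤ 2 * m
      · have hp := hpairs ((x + 1) / 2) (mem_Icc.2 (by omega))
        have h1 : ¬ (2 * m + 1 ≤ x ∧ x ≤ n) := by omega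
        by_cases h0 : x % 2 = 0
        · have h2 : 2 * (x / 2) = x := by omega
          have h3 : 1 ≤ x / 2 ∧ x / 2 ≤ m := by omega
          simp only [h0, if_true, h2, hx, h1, h3, and_false, or_false, true_and, and_self]
        · have h2 : 2 * ((x + 1) / 2) - 1 = x := by omega
          have h3 : 1 ≤ (x + 1) / 2 ∧ (x + 1) / 2 ≤ m := by omega
          rw [h2] at hp
          simp only [h0, if_false, hx, h1, h3, and_false, or_false, true_and, and_self, hp]
      · constructor
        · rintro (h | h)
          · exact absurd h.1 hx
          · exact h.1
        · intro h
          have := mem_Icc.1 (hsub h)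
          exact Or.inr ⟨h, by omega⟩
    · rintro ⟨S, V⟩ h
      rw [mem_coe, mem_product, mem_powerset, mem_powersetCard] at h
      obtain ⟨hS, hV, -⟩ := h
      dsimp only at hS hV
      have hV' : ∀ x ∈ V, 2 * m + 1 ≤ x ∧ x ≤ n := fun x hx => mem_Icc.1 (hV hx)
      refine Prod.ext ?_ ?_
      · ext r
        simp only [mem_filter, mem_union, mem_Icc]
        constructor
        · rintro ⟨hr, h | h⟩
          · have h' := h.2
            rwa [if_pos (by omega), show 2 * r / 2 = r by omega] at h'
          · have := hV' _ h; omega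
        · intro h
          have hr := mem_Icc.1 (hS h)
          refine ⟨hr, Or.inl ⟨by omega, ?_⟩⟩
          rwa [if_pos (by omega), show 2 * r / 2 = r by omega]
      · ext x
        simp only [mem_inter, mem_union, mem_filter, mem_Icc]
        constructor
        · rintro ⟨h | h, h'⟩
          · omega
          · exact h
        · intro h; exact ⟨Or.inr h, hV' x h⟩
  rw [this, card_product, card_powerset, card_powersetCard, Nat.card_Icc, Nat.card_Icc,
    Nat.add_sub_cancel, show n + 1 - (2 * m + 1) = n - 2 * m by omega]

theorem innerPi_gT_self {n m i : ℕ} (hm : 2 * m ≤ n) :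
    innerPi n (gT n m i) (gT n m i) =
      2 ^ m / (n + 1) * (((n - 2 * m).choose i : ℝ) / (n.choose (m + i))) := by
  have h : innerPi n (gT n m i) (gT n m i) =
      ∑ U ∈ supportT n m i, 1 / (((n : ℝ) + 1) * (n.choose (m + i))) := by
    rw [innerPi, supportT, Finset.sum_filter]
    refine Finset.sum_congr rfl fun U hU => ?_
    unfold gT
    split_ifs with hc
    · rw [← mul_pow, neg_one_mul, neg_neg, one_pow, one_mul, piDist,
        card_of_mem_supportT (mem_filter.2 ⟨hU, hc⟩)]
    · ring
  rw [h, Finset.sum_const, card_supportT hm, nsmul_eq_mul, div_mul_div_comm, mul_one_div]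
  push_cast
  rfl

end Norm

section Nonvanishing

theorem exists_gT_ne_zero {n m i : ℕ} (hm : 2 * m ≤ n) (hi : i ≤ n - 2 * m) :
    ∃ U ⊆ Icc 1 n, gT n m i U ≠ 0 := by
  by_contra! h
  have hz : innerPi n (gT n m i) (gT n m i) = 0 :=
    Finset.sum_eq_zero fun U hU => by rw [h U (mem_powerset.1 hU)]; ring
  rw [innerPi_gT_self hm] at hz
  have h1 : (0 : ℝ) < (n - 2 * m).choose i := by exact_mod_cast Nat.choose_pos hi
  have h2 : (0 : ℝ) < n.choose (m + i) := by exact_mod_cast Nat.choose_pos (by omega)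
  have : (0 : ℝ) < 2 ^ m / (n + 1) * (((n - 2 * m).choose i : ℝ) / (n.choose (m + i))) := by
    positivity
  exact this.ne' hz

theorem exists_tauFactor_ne_zero {n r t : ℕ} {f : Finset ℕ → ℝ} (hr : 1 ≤ r) (ht : 2 * r ≤ t)
    (htn : t + 1 ≤ n) (hf : ∃ U ⊆ Icc 1 n, f U ≠ 0) :
    ∃ U ⊆ Icc 1 n, tauFactor r t f U ≠ 0 := by
  obtain ⟨U, hU, hne⟩ := hf
  by_contra! h
  have h1 := h U hU
  have h2 := h (U.image (Equiv.swap t (t + 1)))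
    (image_swap_subset_Icc (mem_Icc.2 (by omega)) (mem_Icc.2 (by omega)) hU)
  simp only [tauFactor, sOp, image_swap_image_swap] at h1 h2
  have hd : (2 : ℝ) ≤ (t : ℝ) - 2 * r + 2 := by
    have : (2 : ℝ) * r ≤ t := by exact_mod_cast ht
    linarith
  set d : ℝ := (t : ℝ) - 2 * r + 2
  have hd0 : d ≠ 0 := by linarith
  have h3 : (d ^ 2 - 1) * f U = 0 := by
    field_simp at h1 h2
    linear_combination d * h2 + h1
  rcases mul_eq_zero.1 h3 with h4 | h4
  · nlinarith
  · exact hne h4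

theorem exists_gQvec_ne_zero {n i : ℕ} {Q : List ℕ} (hQ : IsSYT n Q) (hm : 2 * Q.length ≤ n)
    (hi : i ≤ n - 2 * Q.length) : ∃ U ⊆ Icc 1 n, gQvec n Q i U ≠ 0 :=
  tauQAux_induction (P := fun f => ∃ U ⊆ Icc 1 n, f U ≠ 0)
    (fun _ _ _ hr ht htn hf => exists_tauFactor_ne_zero hr ht htn hf) Q hQ.2.1 1 le_rfl
    (exists_gT_ne_zero hm hi)

theorem card_eq_of_gQvec_ne_zero {n i : ℕ} {Q : List ℕ} (hQ : IsSYT n Q)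
    {U : Finset ℕ} (hU : U ⊆ Icc 1 n) (hne : gQvec n Q i U ≠ 0) : U.card = Q.length + i := by
  refine tauQAux_induction (n := n)
    (P := fun f => ∀ U ⊆ Icc 1 n, f U ≠ 0 → U.card = Q.length + i) ?_ Q hQ.2.1 1 le_rfl ?_
    U hU hne
  · intro r t f hr ht htn hf V hV hV0
    by_cases h : f V = 0
    · rw [← card_image_swap t (t + 1) V]
      refine hf _ (image_swap_subset_Icc (mem_Icc.2 (by omega)) (mem_Icc.2 (by omega)) hV) ?_
      simpa [tauFactor, sOp, h] using hV0
    · exact hf V hV h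
  · intro V hV hV0
    refine card_of_mem_supportT (mem_filter.2 ⟨mem_powerset.2 hV, ?_⟩)
    by_contra h
    exact hV0 (if_neg h)

end Nonvanishing

/-- the family g_Q^{m,i} is pairwise orthogonal with respect to ⟨·,·⟩_π,
each member nonzero, and for the column reading tableau
⟨g_T^{m,i}, g_T^{m,i}⟩_π = (2^m/(n+1)) C(n−2m,i)/C(n,m+i). -/
theorem gQ_orthogonal (n : ℕ) :
    (∀ Q₁ i₁ Q₂ i₂, IsSYT n Q₁ → IsSYT n Q₂ → 2 * Q₁.length ≤ n → 2 * Q₂.length ≤ n →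
      i₁ ≤ n - 2 * Q₁.length → i₂ ≤ n - 2 * Q₂.length → (Q₁, i₁) ≠ (Q₂, i₂) →
      innerPi n (gQvec n Q₁ i₁) (gQvec n Q₂ i₂) = 0) ∧
    (∀ Q i, IsSYT n Q → 2 * Q.length ≤ n → i ≤ n - 2 * Q.length →
      ∃ U ⊆ Finset.Icc 1 n, gQvec n Q i U ≠ 0) ∧
    (∀ m i, 2 * m ≤ n → i ≤ n - 2 * m →
      innerPi n (gT n m i) (gT n m i) =
        2 ^ m / (n + 1) * (((n - 2 * m).choose i : ℝ) / (n.choose (m + i)))) := by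
  refine ⟨?_, fun Q i hQ hm hi => exists_gQvec_ne_zero hQ hm hi,
    fun m i hm _ => innerPi_gT_self hm⟩
  intro Q₁ i₁ Q₂ i₂ h₁ h₂ _ _ _ _ hne
  by_cases hQ : Q₁ = Q₂
  · subst hQ
    refine Finset.sum_eq_zero fun U hU => ?_
    rw [mem_powerset] at hU
    by_cases hz₁ : gQvec n Q₁ i₁ U = 0
    · rw [hz₁]; ring
    by_cases hz₂ : gQvec n Q₁ i₂ U = 0
    · rw [hz₂]; ring
    have hc₁ := card_eq_of_gQvec_ne_zero h₁ hU hz₁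
    have hc₂ := card_eq_of_gQvec_ne_zero h₁ hU hz₂
    exact absurd (by rw [show i₁ = i₂ by omega]) hne
  · obtain ⟨k, hk, hc⟩ := h₁.exists_content_ne h₂ hQ
    exact (isMurphyEigen_gQvec h₁ i₁).innerPi_eq_zero (isMurphyEigen_gQvec h₂ i₂) hk hc
end

section
/- For all integers n ≥ 3 and s ≥ 1, the chi-square distance from the state e_n satisfies the exact formula χ²_{e_n}(s) = Σ_{ℓ even, 2 ≤ ℓ ≤ n} (C(n−1,ℓ) − ℓ·C(n−1,ℓ−1))² · [(2ℓ+1)·(ℓ!)²·(n+1) / Π_{i=−ℓ+1}^{ℓ+1}(n+i)] · β_{ℓ/2}^{2s} + Σ_{ℓ odd, 1 ≤ ℓ ≤ n−2} ((2+ℓ)·C(n−2,ℓ))² · [(ℓ+1)(2ℓ+3)(ℓ!)²(n−1)²(n+1) / ((ℓ+2)·Π_{i=−ℓ−1}^{ℓ+1}(n+i))] · β_{(1+ℓ)/2}^{2s}, where β_k = C(2k,k)²/16^k. -/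
open Finset

attribute [local instance] Classical.propDecidable

/-- The even moments `C(2k,k)/4^k` of the arcsine law. -/
noncomputable def arcsineMoment (k : ℕ) : ℝ := (k.centralBinom : ℝ) / 4 ^ k

theorem arcsineMoment_zero : arcsineMoment 0 = 1 := by simp [arcsineMoment]

theorem arcsineMoment_succ (k : ℕ) :
    ((k : ℝ) + 1) * arcsineMoment (k + 1) = (k + 1 / 2) * arcsineMoment k := by
  have h : ((k : ℝ) + 1) * ((k + 1).centralBinom : ℝ) = 2 * (2 * k + 1) * k.centralBinom := by
    exact_mod_cast Nat.succ_mul_centralBinom_succ k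
  unfold arcsineMoment
  rw [pow_succ, ← mul_div_assoc, h]
  field_simp
  ring

/-- Summation by parts for the convolution of arcsine moments. -/
theorem succ_mul_sum_arcsineMoment (φ : ℕ → ℝ) (n : ℕ) :
    ((n : ℝ) + 1) * ∑ p ∈ antidiagonal (n + 1),
        arcsineMoment p.1 * arcsineMoment p.2 * φ p.1 =
      ∑ p ∈ antidiagonal n, arcsineMoment p.1 * arcsineMoment p.2 *
        (((p.1 : ℝ) + 1 / 2) * φ (p.1 + 1) + ((p.2 : ℝ) + 1 / 2) * φ p.1) := by
  have h1 : ∑ p ∈ antidiagonal (n + 1),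
      (p.1 : ℝ) * (arcsineMoment p.1 * arcsineMoment p.2 * φ p.1) =
      ∑ p ∈ antidiagonal n, arcsineMoment p.1 * arcsineMoment p.2 *
        (((p.1 : ℝ) + 1 / 2) * φ (p.1 + 1)) := by
    rw [Nat.sum_antidiagonal_succ]
    simp only [Nat.cast_zero, zero_mul, zero_add]
    refine sum_congr rfl fun p _ => ?_
    push_cast
    linear_combination arcsineMoment p.2 * φ (p.1 + 1) * arcsineMoment_succ p.1
  have h2 : ∑ p ∈ antidiagonal (n + 1),
      (p.2 : ℝ) * (arcsineMoment p.1 * arcsineMoment p.2 * φ p.1) =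
      ∑ p ∈ antidiagonal n, arcsineMoment p.1 * arcsineMoment p.2 *
        (((p.2 : ℝ) + 1 / 2) * φ p.1) := by
    rw [Nat.sum_antidiagonal_succ']
    simp only [Nat.cast_zero, zero_mul, zero_add]
    refine sum_congr rfl fun p _ => ?_
    push_cast
    linear_combination arcsineMoment p.1 * φ p.1 * arcsineMoment_succ p.2
  simp only [mul_add, sum_add_distrib] at h1 h2 ⊢
  rw [← h1, ← h2, ← sum_add_distrib, mul_sum]
  refine sum_congr rfl fun p hp => ?_
  have : (p.1 : ℝ) + p.2 = n + 1 := by exact_mod_cast mem_antidiagonal.1 hp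
  linear_combination (-(arcsineMoment p.1 * arcsineMoment p.2 * φ p.1)) * this

theorem cast_sub_mul_choose (n k : ℕ) :
    ((n : ℝ) - k) * n.choose k = (k + 1) * n.choose (k + 1) := by
  rcases le_or_gt k n with h | h
  · have := Nat.choose_succ_right_eq n k
    rw [← Nat.cast_sub h]
    norm_cast
    linarith
  · simp [Nat.choose_eq_zero_of_lt h, Nat.choose_eq_zero_of_lt (h.trans (Nat.lt_succ_self k))]

/-- Factorial moments of the discrete arcsine law. -/
theorem sum_arcsineMoment_mul_choose (n r : ℕ) :
    ∑ p ∈ antidiagonal n, arcsineMoment p.1 * arcsineMoment p.2 * (p.1.choose r : ℝ) =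
      n.choose r * arcsineMoment r := by
  induction n generalizing r with
  | zero => cases r <;> simp [arcsineMoment_zero]
  | succ n ih =>
    have hn : (n : ℝ) + 1 ≠ 0 := by positivity
    have key := succ_mul_sum_arcsineMoment (fun a => (a.choose r : ℝ)) n
    apply mul_left_cancel₀ hn
    rw [key]
    cases r with
    | zero =>
      have h0 := ih 0
      simp only [Nat.choose_zero_right, Nat.cast_one, mul_one] at h0 ⊢
      rw [← h0, mul_sum]
      refine sum_congr rfl fun p hp => ?_
      have : (p.1 : ℝ) + p.2 = n := by exact_mod_cast mem_antidiagonal.1 hp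
      linear_combination (arcsineMoment p.1 * arcsineMoment p.2) * this
    | succ r =>
      have e : ∀ p ∈ antidiagonal n, arcsineMoment p.1 * arcsineMoment p.2 *
          (((p.1 : ℝ) + 1 / 2) * ((p.1 + 1).choose (r + 1) : ℕ) +
            ((p.2 : ℝ) + 1 / 2) * (p.1.choose (r + 1) : ℕ)) =
          ((n : ℝ) + r + 2) * (arcsineMoment p.1 * arcsineMoment p.2 * (p.1.choose (r + 1) : ℕ)) +
            ((r : ℝ) + 1 / 2) * (arcsineMoment p.1 * arcsineMoment p.2 * (p.1.choose r : ℕ)) := by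
        intro p hp
        have h1 : (p.1 : ℝ) + p.2 = n := by exact_mod_cast mem_antidiagonal.1 hp
        have h2 := cast_sub_mul_choose p.1 r
        rw [Nat.choose_succ_succ, Nat.cast_add]
        linear_combination (arcsineMoment p.1 * arcsineMoment p.2) *
          ((p.1.choose (r + 1) : ℕ) * h1 + h2)
      rw [sum_congr rfl e, sum_add_distrib, ← mul_sum, ← mul_sum, ih, ih, Nat.choose_succ_succ,
        Nat.cast_add]
      have h2 := cast_sub_mul_choose n r
      have h3 := arcsineMoment_succ r
      linear_combination (-(n.choose r : ℝ)) * h3 - arcsineMoment (r + 1) * h2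

/-- The exponential moments `μ_k / k!`. -/
noncomputable def scaledMoment (k : ℕ) : ℝ := arcsineMoment k / k.factorial

theorem scaledMoment_succ (k : ℕ) :
    ((k : ℝ) + 1) ^ 2 * scaledMoment (k + 1) = (k + 1 / 2) * scaledMoment k := by
  have h := arcsineMoment_succ k
  have hk : (k.factorial : ℝ) ≠ 0 := by positivity
  unfold scaledMoment
  rw [Nat.factorial_succ]
  push_cast
  field_simp
  linarith

theorem sum_sq_fst_mul (φ : ℕ → ℕ → ℝ) (n : ℕ) :
    ∑ p ∈ antidiagonal (n + 1),
        (-1) ^ p.2 * scaledMoment p.1 * scaledMoment p.2 * ((p.1 : ℝ) ^ 2 * φ p.1 p.2) =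
      ∑ p ∈ antidiagonal n,
        (-1) ^ p.2 * scaledMoment p.1 * scaledMoment p.2 *
          (((p.1 : ℝ) + 1 / 2) * φ (p.1 + 1) p.2) := by
  rw [Nat.sum_antidiagonal_succ]
  simp only [Nat.cast_zero]
  rw [zero_pow two_ne_zero, zero_mul, mul_zero, zero_add]
  refine sum_congr rfl fun p _ => ?_
  push_cast
  linear_combination (-1) ^ p.2 * scaledMoment p.2 * φ (p.1 + 1) p.2 * scaledMoment_succ p.1

theorem sum_sq_snd_mul (φ : ℕ → ℕ → ℝ) (n : ℕ) :
    ∑ p ∈ antidiagonal (n + 1),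
        (-1) ^ p.2 * scaledMoment p.1 * scaledMoment p.2 * ((p.2 : ℝ) ^ 2 * φ p.1 p.2) =
      -∑ p ∈ antidiagonal n,
        (-1) ^ p.2 * scaledMoment p.1 * scaledMoment p.2 *
          (((p.2 : ℝ) + 1 / 2) * φ p.1 (p.2 + 1)) := by
  rw [Nat.sum_antidiagonal_succ', ← sum_neg_distrib]
  simp only [Nat.cast_zero]
  rw [zero_pow two_ne_zero, zero_mul, mul_zero, zero_add]
  refine sum_congr rfl fun p _ => ?_
  push_cast
  rw [pow_succ]
  linear_combination (-(-1) ^ p.2 * scaledMoment p.1 * φ p.1 (p.2 + 1)) * scaledMoment_succ p.2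

/-- The scaled moments of the difference of two independent arcsine variables. -/
noncomputable def diffMoment (r : ℕ) : ℝ :=
  ∑ p ∈ antidiagonal r, (-1) ^ p.2 * scaledMoment p.1 * scaledMoment p.2

theorem diffMoment_succ_succ (r : ℕ) :
    ((r : ℝ) + 2) ^ 3 * diffMoment (r + 2) = (r + 1) * diffMoment r := by
  have e : ((r : ℝ) + 2) ^ 3 * diffMoment (r + 2) =
      ∑ p ∈ antidiagonal (r + 1 + 1), (-1) ^ p.2 * scaledMoment p.1 * scaledMoment p.2 *
          ((p.1 : ℝ) ^ 2 * ((p.1 : ℝ) + 3 * p.2)) +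
        ∑ p ∈ antidiagonal (r + 1 + 1), (-1) ^ p.2 * scaledMoment p.1 * scaledMoment p.2 *
          ((p.2 : ℝ) ^ 2 * (3 * (p.1 : ℝ) + p.2)) := by
    unfold diffMoment
    rw [mul_sum, ← sum_add_distrib]
    refine sum_congr rfl fun p hp => ?_
    have h1 : (r : ℝ) + 2 = p.1 + p.2 := by
      have := mem_antidiagonal.1 hp
      rw [← Nat.cast_add, this]
      push_cast
      ring
    rw [h1]
    ring
  have f : ∑ p ∈ antidiagonal (r + 1), (-1) ^ p.2 * scaledMoment p.1 * scaledMoment p.2 *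
          ((p.1 : ℝ) ^ 2 * 1) +
        ∑ p ∈ antidiagonal (r + 1), (-1) ^ p.2 * scaledMoment p.1 * scaledMoment p.2 *
          ((p.2 : ℝ) ^ 2 * (-1)) = (r + 1) * diffMoment r := by
    rw [sum_sq_fst_mul (fun _ _ => 1), sum_sq_snd_mul (fun _ _ => -1), diffMoment, mul_sum,
      ← sum_neg_distrib, ← sum_add_distrib]
    refine sum_congr rfl fun p hp => ?_
    have h1 : (r : ℝ) = p.1 + p.2 := by exact_mod_cast (mem_antidiagonal.1 hp).symm
    rw [h1]
    ring
  rw [e, sum_sq_fst_mul (fun a b => (a : ℝ) + 3 * b), sum_sq_snd_mul (fun a b => 3 * (a : ℝ) + b),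
    ← f, ← sum_neg_distrib, ← sum_add_distrib, ← sum_add_distrib]
  refine sum_congr rfl fun p hp => ?_
  push_cast
  ring

theorem factorial_mul_diffMoment_two_mul (t : ℕ) :
    ((2 * t).factorial : ℝ) * diffMoment (2 * t) = arcsineMoment t ^ 2 := by
  induction t with
  | zero => simp [diffMoment, scaledMoment, arcsineMoment]
  | succ t ih =>
    have h1 := diffMoment_succ_succ (2 * t)
    have h2 := arcsineMoment_succ t
    have h3 : ((2 * t : ℕ) : ℝ) + 2 ≠ 0 := by positivity
    have h4 : (t : ℝ) + 1 ≠ 0 := by positivity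
    rw [show 2 * (t + 1) = 2 * t + 2 by ring, Nat.factorial_succ, Nat.factorial_succ]
    have h5 : arcsineMoment (t + 1) = (t + 1 / 2) * arcsineMoment t / (t + 1) := by
      rw [← h2]; field_simp
    have h6 : diffMoment (2 * t + 2) = (2 * t + 1) * diffMoment (2 * t) / (2 * t + 2) ^ 3 := by
      push_cast at h1
      have : (2 * (t : ℝ) + 2) ≠ 0 := by positivity
      rw [← h1]; field_simp
    rw [h5, h6]
    push_cast
    have : (2 * (t : ℝ) + 2) ≠ 0 := by positivity
    rw [div_pow, mul_pow, ← ih]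
    field_simp
    ring

theorem diffMoment_odd (t : ℕ) : diffMoment (2 * t + 1) = 0 := by
  induction t with
  | zero =>
    simp [diffMoment, Nat.antidiagonal_succ, scaledMoment]
    ring
  | succ t ih =>
    have h1 := diffMoment_succ_succ (2 * t + 1)
    rw [ih, mul_zero] at h1
    have h3 : ((2 * t + 1 : ℕ) : ℝ) + 2 ≠ 0 := by positivity
    exact (mul_eq_zero.1 h1).resolve_left (pow_ne_zero _ h3)

/-- The eigenvalues of the binary Burnside process, indexed by degree. -/
noncomputable def burnsideEigenvalue (r : ℕ) : ℝ := r.factorial * diffMoment r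

/-- `p` has degree at most `d`, with coefficient `c` in degree `d`. -/
def HasTop (p : Polynomial ℝ) (d : ℕ) (c : ℝ) : Prop := p.natDegree ≤ d ∧ p.coeff d = c

namespace HasTop

open Polynomial

variable {p q : ℝ[X]} {d e : ℕ} {a b : ℝ}

theorem add (hp : HasTop p d a) (hq : HasTop q d b) : HasTop (p + q) d (a + b) :=
  ⟨natDegree_add_le_of_degree_le hp.1 hq.1, by rw [coeff_add, hp.2, hq.2]⟩

theorem neg (hp : HasTop p d a) : HasTop (-p) d (-a) :=
  ⟨by rw [natDegree_neg]; exact hp.1, by rw [coeff_neg, hp.2]⟩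

theorem sub (hp : HasTop p d a) (hq : HasTop q d b) : HasTop (p - q) d (a - b) := by
  rw [sub_eq_add_neg, sub_eq_add_neg]
  exact hp.add hq.neg

theorem C_mul (hp : HasTop p d a) (c : ℝ) : HasTop (C c * p) d (c * a) :=
  ⟨(natDegree_C_mul_le _ _).trans hp.1, by rw [coeff_C_mul, hp.2]⟩

theorem mul (hp : HasTop p d a) (hq : HasTop q e b) : HasTop (p * q) (d + e) (a * b) :=
  ⟨natDegree_mul_le_of_le hp.1 hq.1, by
    rw [coeff_mul_add_eq_of_natDegree_le hp.1 hq.1, hp.2, hq.2]⟩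

theorem sum {ι : Type*} {s : Finset ι} {p : ι → ℝ[X]} {a : ι → ℝ}
    (h : ∀ i ∈ s, HasTop (p i) d (a i)) : HasTop (∑ i ∈ s, p i) d (∑ i ∈ s, a i) :=
  ⟨natDegree_sum_le_of_forall_le s p fun i hi => (h i hi).1, by
    rw [finsetSum_coeff]
    exact sum_congr rfl fun i hi => (h i hi).2⟩

theorem of_eq (hp : HasTop p d a) (h : a = b) : HasTop p d b := h ▸ hp

/-- The backward difference lowers the degree by one. -/
theorem backward_difference (hp : HasTop p (d + 1) a) :
    HasTop (p - p.comp (X - C 1)) d ((d + 1) * a) := by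
  have key : ∀ k, (p - p.comp (X - C 1)).coeff k =
      ∑ i ∈ range (d + 2), p.coeff i * ((X ^ i).coeff k - ((X - C (1 : ℝ)) ^ i).coeff k) := by
    intro k
    conv_lhs => rw [as_sum_range' p (d + 2) (by have := hp.1; omega)]
    rw [← coe_compRingHom_apply, map_sum, ← sum_sub_distrib, finsetSum_coeff]
    refine sum_congr rfl fun i _ => ?_
    rw [coe_compRingHom_apply, ← C_mul_X_pow_eq_monomial, mul_comp, C_comp, X_pow_comp, ← mul_sub, coeff_C_mul, coeff_sub]
  have hX : ∀ i k : ℕ, ((X - C (1 : ℝ)) ^ i).coeff k = (-1 : ℝ) ^ (i - k) * (i.choose k : ℝ) := by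
    intro i k
    rw [← coeff_X_add_C_pow, map_neg, sub_eq_add_neg]
  have hdeg : ∀ k, d < k → (p - p.comp (X - C 1)).coeff k = 0 := by
    intro k hk
    rw [key]
    refine sum_eq_zero fun i hi => ?_
    rw [hX, coeff_X_pow]
    have := mem_range.1 hi
    rcases (show i < k ∨ i = k by omega) with h | h
    · simp [h.ne', Nat.choose_eq_zero_of_lt h]
    · simp [h]
  refine ⟨natDegree_le_iff_coeff_eq_zero.2 hdeg, ?_⟩
  rw [key, sum_range_succ, sum_range_succ, sum_eq_zero, zero_add, hX, hX, hp.2]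
  · simp [coeff_X_pow, Nat.choose_succ_self_right]
    ring
  · intro i hi
    have := mem_range.1 hi
    rw [hX, coeff_X_pow, Nat.choose_eq_zero_of_lt this]
    simp [this.ne']

end HasTop

/-- The binomial coefficient `C(f, k)` of a polynomial. -/
noncomputable def binomPoly (f : Polynomial ℝ) : ℕ → Polynomial ℝ
  | 0 => 1
  | k + 1 => Polynomial.C (((k : ℝ) + 1)⁻¹) * (binomPoly f k * (f - Polynomial.C (k : ℝ)))

theorem eval_binomPoly (f : Polynomial ℝ) (x : ℝ) (N k : ℕ) (h : f.eval x = N) :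
    (binomPoly f k).eval x = N.choose k := by
  induction k with
  | zero => simp [binomPoly]
  | succ k ih =>
    have := cast_sub_mul_choose N k
    have hk : (k : ℝ) + 1 ≠ 0 := by positivity
    simp only [binomPoly, Polynomial.eval_mul, Polynomial.eval_C, Polynomial.eval_sub, ih, h]
    field_simp
    linarith

theorem hasTop_binomPoly {f : Polynomial ℝ} {c : ℝ} (hf : HasTop f 1 c) (k : ℕ) :
    HasTop (binomPoly f k) k (c ^ k / k.factorial) := by
  induction k with
  | zero => exact ⟨by simp [binomPoly], by simp [binomPoly]⟩
  | succ k ih =>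
    have h0 : HasTop (Polynomial.C (k : ℝ)) 1 0 :=
      ⟨by simp, by rw [Polynomial.coeff_C]; simp⟩
    refine ((ih.mul (hf.sub h0)).C_mul _).of_eq ?_
    rw [Nat.factorial_succ]
    push_cast
    field_simp
    ring

theorem hasTop_X_sub_C (u : ℝ) : HasTop (Polynomial.X - Polynomial.C u) 1 1 :=
  ⟨by compute_degree, by simp⟩

theorem hasTop_C_sub_X (u : ℝ) : HasTop (Polynomial.C u - Polynomial.X) 1 (-1) :=
  ⟨by compute_degree, by simp⟩

theorem hasTop_binomPoly_mul (u v : ℝ) (k l : ℕ) :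
    HasTop (binomPoly (Polynomial.X - Polynomial.C u) k *
      binomPoly (Polynomial.C v - Polynomial.X) l) (k + l)
      ((-1) ^ l / (k.factorial * l.factorial)) :=
  ((hasTop_binomPoly (hasTop_X_sub_C u) k).mul (hasTop_binomPoly (hasTop_C_sub_X v) l)).of_eq
    (by rw [one_pow, div_mul_div_comm, one_mul])

theorem cast_add_choose_mul (k l : ℕ) :
    ((k + l).choose k : ℝ) * k.factorial * l.factorial = (k + l).factorial := by
  have := Nat.choose_mul_factorial_mul_factorial (Nat.le_add_right k l)
  rw [Nat.add_sub_cancel_left] at this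
  exact_mod_cast this

theorem sum_choose_mul_choose (M a b : ℕ) :
    ∑ p ∈ antidiagonal M, p.1.choose a * p.2.choose b = (M + 1).choose (a + b + 1) := by
  induction M generalizing b with
  | zero => cases a <;> cases b <;> simp [Nat.choose_eq_zero_of_lt]
  | succ M ih =>
    rw [Nat.sum_antidiagonal_succ']
    cases b with
    | zero =>
      have h := ih 0
      simp only [Nat.choose_zero_right, mul_one] at h ⊢
      rw [h, add_zero, Nat.choose_succ_succ (M + 1) a]
    | succ b =>
      simp only [Nat.choose_succ_succ', mul_add, sum_add_distrib, Nat.choose_zero_succ, mul_zero,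
        zero_add]
      rw [ih b, ih (b + 1), ← add_assoc, ← Nat.choose_succ_succ', ← Nat.choose_succ_succ']
      exact Nat.choose_succ_succ' _ _

/-- The `t`-th difference, with step matching the shifts, of `C(i, ·) C(j, ·)`. -/
noncomputable def hahnKernel (α t i j : ℕ) : ℝ :=
  ∑ p ∈ antidiagonal t, (t.choose p.1 : ℝ) *
    ((-1) ^ p.1 * i.choose (α + p.1) * j.choose (α + p.2))

theorem hahnKernel_succ (α t i j : ℕ) :
    hahnKernel α (t + 1) i j =
      hahnKernel (α + 1) t (i + 1) j - hahnKernel (α + 1) t i (j + 1) := by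
  unfold hahnKernel
  rw [sum_antidiagonal_choose_succ_mul
      (fun k l => ((-1) ^ k * (i.choose (α + k) : ℝ) * j.choose (α + l))),
    ← sum_add_distrib, ← sum_sub_distrib]
  refine sum_congr rfl fun p hp => ?_
  have hp : p.1 + p.2 = t := mem_antidiagonal.1 hp
  have hs : t.choose p.2 = t.choose p.1 := Nat.choose_symm_of_eq_add (by omega)
  rw [hs, show α + 1 + p.1 = (α + p.1) + 1 by ring, show α + 1 + p.2 = (α + p.2) + 1 by ring,
    ← add_assoc, ← add_assoc, Nat.choose_succ_succ i, Nat.choose_succ_succ j, pow_succ]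
  push_cast
  ring

theorem hahnKernel_zero_left (α t j : ℕ) : hahnKernel (α + 1) t 0 j = 0 := by
  refine sum_eq_zero fun p _ => ?_
  simp [Nat.choose_eq_zero_of_lt, show α + 1 + p.1 = (α + p.1) + 1 by ring]

theorem hahnKernel_zero_right (α t i : ℕ) : hahnKernel (α + 1) t i 0 = 0 := by
  refine sum_eq_zero fun p _ => ?_
  simp [Nat.choose_eq_zero_of_lt, show α + 1 + p.2 = (α + p.2) + 1 by ring]

theorem sum_hahnKernel_mul {q : Polynomial ℝ} {t : ℕ} {c : ℝ} (hq : HasTop q t c) (α M : ℕ) :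
    ∑ p ∈ antidiagonal M, hahnKernel α t p.1 p.2 * q.eval (p.1 : ℝ) =
      (-1) ^ t * t.factorial * (M + t + 1).choose (2 * α + 2 * t + 1) * c := by
  induction t generalizing q c α M with
  | zero =>
    have hq0 : q = Polynomial.C c := by
      rw [Polynomial.eq_C_of_natDegree_le_zero hq.1, hq.2]
    have h := sum_choose_mul_choose M α α
    rw [hq0]
    simp only [Polynomial.eval_C, ← sum_mul]
    simp only [hahnKernel, Nat.antidiagonal_zero, sum_singleton]
    simp only [Nat.choose_self, Nat.cast_one, pow_zero, one_mul, add_zero, mul_zero,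
      Nat.factorial_zero]
    rw [two_mul, ← h]
    push_cast
    rfl
  | succ t ih =>
    have h := ih hq.backward_difference (α + 1) (M + 1)
    simp only [Polynomial.eval_sub, Polynomial.eval_comp, Polynomial.eval_X, Polynomial.eval_C,
      mul_sub, sum_sub_distrib] at h
    rw [Nat.sum_antidiagonal_succ', Nat.sum_antidiagonal_succ, hahnKernel_zero_left,
      hahnKernel_zero_right] at h
    simp only [zero_mul, zero_add, Nat.cast_add, Nat.cast_one, add_sub_cancel_right] at h
    simp only [hahnKernel_succ, sub_mul, sum_sub_distrib]
    rw [show 2 * α + 2 * (t + 1) + 1 = 2 * (α + 1) + 2 * t + 1 by ring,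
      show M + (t + 1) + 1 = M + 1 + t + 1 by ring, Nat.factorial_succ, pow_succ]
    push_cast
    linear_combination -h

/-- Hahn polynomials on `{m, …, n - m}` with both parameters equal to `m`. -/
noncomputable def hahnPoly (m n ℓ : ℕ) : Polynomial ℝ :=
  ∑ p ∈ antidiagonal ℓ, Polynomial.C ((-1) ^ p.1 * ((2 * m + ℓ).choose (m + p.1) : ℝ)) *
    (binomPoly (Polynomial.X - Polynomial.C (m : ℝ)) p.1 *
      binomPoly (Polynomial.C ((n : ℝ) - m) - Polynomial.X) p.2)

theorem hasTop_hahnPoly (m n ℓ : ℕ) :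
    HasTop (hahnPoly m n ℓ) ℓ ((-1) ^ ℓ / ℓ.factorial * (2 * m + 2 * ℓ).choose (m + ℓ)) := by
  have h : HasTop (hahnPoly m n ℓ) ℓ (∑ p ∈ antidiagonal ℓ,
      (-1) ^ p.1 * ((2 * m + ℓ).choose (m + p.1) : ℝ) *
        ((-1) ^ p.2 / (p.1.factorial * p.2.factorial))) := by
    refine HasTop.sum fun p hp => ?_
    have := (hasTop_binomPoly_mul (m : ℝ) ((n : ℝ) - m) p.1 p.2).C_mul
      ((-1) ^ p.1 * ((2 * m + ℓ).choose (m + p.1) : ℝ))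
    rwa [mem_antidiagonal.1 hp] at this
  refine h.of_eq ?_
  have hw : (2 * m + 2 * ℓ).choose (m + ℓ) =
      ∑ p ∈ antidiagonal ℓ, (2 * m + ℓ).choose (m + p.1) * ℓ.choose p.1 := by
    rw [show 2 * m + 2 * ℓ = ℓ + (2 * m + ℓ) by ring, Nat.add_choose_eq,
      Nat.sum_antidiagonal_eq_sum_range_succ_mk, Nat.sum_antidiagonal_eq_sum_range_succ_mk]
    refine (sum_subset_zero_on_sdiff (range_mono (by omega)) (fun k hk => ?_)
      fun k hk => ?_).symm
    · simp only [mem_sdiff, mem_range] at hk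
      simp [Nat.choose_eq_zero_of_lt (show ℓ < k by omega)]
    · have := mem_range.1 hk
      rw [mul_comm, Nat.choose_symm_of_eq_add (show 2 * m + ℓ = (m + k) + (m + ℓ - k) by omega)]
  rw [hw, Nat.cast_sum, mul_sum]
  refine sum_congr rfl fun p hp => ?_
  have hp : p.1 + p.2 = ℓ := mem_antidiagonal.1 hp
  have hc : ((p.1 + p.2).choose p.1 : ℝ) * p.1.factorial * p.2.factorial = (p.1 + p.2).factorial := by
    exact cast_add_choose_mul p.1 p.2
  subst hp
  rw [pow_add]
  push_cast
  field_simp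
  linear_combination (-((2 * m + (p.1 + p.2)).choose (m + p.1) : ℝ)) * hc

theorem eval_hahnPoly (m i j ℓ : ℕ) :
    (hahnPoly m (m + i + (m + j)) ℓ).eval ((m + i : ℕ) : ℝ) =
      ∑ p ∈ antidiagonal ℓ, (-1) ^ p.1 * ((2 * m + ℓ).choose (m + p.1) : ℝ) *
        (i.choose p.1 * j.choose p.2) := by
  rw [hahnPoly, Polynomial.eval_finsetSum]
  refine sum_congr rfl fun p _ => ?_
  rw [Polynomial.eval_mul, Polynomial.eval_C, Polynomial.eval_mul,
    eval_binomPoly _ _ i _ (by simp), eval_binomPoly _ _ j _ (by simp; ring)]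

/-- The normalizing constant in the Rodrigues formula. -/
noncomputable def rodriguesConst (m ℓ : ℕ) : ℝ :=
  (2 * m + ℓ).factorial / (ℓ.factorial * m.factorial * m.factorial)

/-- Rodrigues formula. -/
theorem weight_mul_eval_hahnPoly (m i j ℓ : ℕ) :
    (i.choose m : ℝ) * j.choose m * (hahnPoly m (i + j) ℓ).eval (i : ℝ) =
      rodriguesConst m ℓ * hahnKernel m ℓ i j := by
  rcases lt_or_ge i m with hi | hi
  · rw [Nat.choose_eq_zero_of_lt hi, hahnKernel, sum_eq_zero]
    · simp
    · intro p _
      rw [Nat.choose_eq_zero_of_lt (show i < m + p.1 by omega)]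
      simp
  rcases lt_or_ge j m with hj | hj
  · rw [Nat.choose_eq_zero_of_lt hj, hahnKernel, sum_eq_zero]
    · simp
    · intro p _
      rw [Nat.choose_eq_zero_of_lt (show j < m + p.2 by omega)]
      simp
  obtain ⟨i, rfl⟩ := Nat.exists_eq_add_of_le hi
  obtain ⟨j, rfl⟩ := Nat.exists_eq_add_of_le hj
  rw [eval_hahnPoly, hahnKernel, mul_sum, mul_sum]
  refine sum_congr rfl fun p hp => ?_
  have hp : p.1 + p.2 = ℓ := mem_antidiagonal.1 hp
  subst hp
  have e1 : ∀ a b : ℕ, ((m + a).choose m : ℝ) * a.choose b * m.factorial * b.factorial =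
      (m + a).choose (m + b) * (m + b).factorial := by
    intro a b
    rcases lt_or_ge a b with h | h
    · simp [Nat.choose_eq_zero_of_lt h, Nat.choose_eq_zero_of_lt (show m + a < m + b by omega)]
    obtain ⟨c, rfl⟩ := Nat.exists_eq_add_of_le h
    have h1 := cast_add_choose_mul m (b + c)
    have h2 := cast_add_choose_mul b c
    have h3 := cast_add_choose_mul (m + b) c
    rw [add_assoc] at h3
    have hc : (c.factorial : ℝ) ≠ 0 := by positivity
    apply mul_right_cancel₀ hc
    rw [h3, ← h1, ← h2]
    ring
  have h1 := e1 i p.1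
  have h2 := e1 j p.2
  have h3 : (((p.1 + p.2).choose p.1 : ℕ) : ℝ) * p.1.factorial * p.2.factorial =
      (p.1 + p.2).factorial := by
    exact cast_add_choose_mul p.1 p.2
  have h4 : ((2 * m + (p.1 + p.2)).choose (m + p.1) : ℝ) * (m + p.1).factorial *
      (m + p.2).factorial = (2 * m + (p.1 + p.2)).factorial := by
    rw [show 2 * m + (p.1 + p.2) = m + p.1 + (m + p.2) by ring]
    exact cast_add_choose_mul (m + p.1) (m + p.2)
  have hk : (p.1.factorial * p.2.factorial : ℝ) ≠ 0 := by positivity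
  rw [rodriguesConst]
  field_simp
  apply mul_right_cancel₀ hk
  linear_combination
    (2 * m + (p.1 + p.2)).choose (m + p.1) * ((p.1 + p.2).factorial : ℝ) *
      (((m + j).choose m : ℝ) * j.choose p.2 * m.factorial * p.2.factorial * h1 +
        (m + i).choose (m + p.1) * (m + p.1).factorial * h2) +
    ((p.1 + p.2).factorial : ℝ) * (m + i).choose (m + p.1) * (m + j).choose (m + p.2) * h4 -
    ((2 * m + (p.1 + p.2)).factorial : ℝ) * (m + i).choose (m + p.1) *
      (m + j).choose (m + p.2) * h3

/-- Orthogonality and norm of the Hahn polynomials. -/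
theorem sum_weight_hahnPoly_mul {q : Polynomial ℝ} {ℓ : ℕ} {c : ℝ} (hq : HasTop q ℓ c) (m n : ℕ) :
    ∑ p ∈ antidiagonal n, (p.1.choose m : ℝ) * p.2.choose m *
        (hahnPoly m n ℓ).eval (p.1 : ℝ) * q.eval (p.1 : ℝ) =
      rodriguesConst m ℓ * ((-1) ^ ℓ * ℓ.factorial * (n + ℓ + 1).choose (2 * m + 2 * ℓ + 1) * c) := by
  rw [← sum_hahnKernel_mul hq, mul_sum]
  refine sum_congr rfl fun p hp => ?_
  rw [← mem_antidiagonal.1 hp, weight_mul_eval_hahnPoly, mul_assoc]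

/-- The squared norm of the Hahn polynomials. -/
noncomputable def hahnNorm (m n ℓ : ℕ) : ℝ :=
  rodriguesConst m ℓ * ((n + ℓ + 1).choose (2 * m + 2 * ℓ + 1) * (2 * m + 2 * ℓ).choose (m + ℓ))

theorem sum_weight_hahnPoly_sq (m n ℓ : ℕ) :
    ∑ p ∈ antidiagonal n, (p.1.choose m : ℝ) * p.2.choose m *
        (hahnPoly m n ℓ).eval (p.1 : ℝ) * (hahnPoly m n ℓ).eval (p.1 : ℝ) = hahnNorm m n ℓ := by
  rw [sum_weight_hahnPoly_mul (hasTop_hahnPoly m n ℓ), hahnNorm]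
  have h : ((-1 : ℝ) ^ ℓ) * (-1) ^ ℓ = 1 := by rw [← mul_pow]; norm_num
  field_simp
  linear_combination (rodriguesConst m ℓ * (n + ℓ + 1).choose (2 * m + 2 * ℓ + 1) *
    (2 * m + 2 * ℓ).choose (m + ℓ)) * h

theorem hahnNorm_pos {m n ℓ : ℕ} (h : 2 * m + ℓ ≤ n) : 0 < hahnNorm m n ℓ := by
  have h1 : 0 < (n + ℓ + 1).choose (2 * m + 2 * ℓ + 1) := Nat.choose_pos (by omega)
  have h2 : 0 < (2 * m + 2 * ℓ).choose (m + ℓ) := Nat.choose_pos (by omega)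
  unfold hahnNorm rodriguesConst
  positivity

theorem sum_weight_hahnPoly_hahnPoly {m n k ℓ : ℕ} (h : k ≠ ℓ) :
    ∑ p ∈ antidiagonal n, (p.1.choose m : ℝ) * p.2.choose m *
        (hahnPoly m n k).eval (p.1 : ℝ) * (hahnPoly m n ℓ).eval (p.1 : ℝ) = 0 := by
  have key : ∀ {k ℓ : ℕ}, k < ℓ → ∑ p ∈ antidiagonal n, (p.1.choose m : ℝ) * p.2.choose m *
        (hahnPoly m n ℓ).eval (p.1 : ℝ) * (hahnPoly m n k).eval (p.1 : ℝ) = 0 := by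
    intro k ℓ h
    have hk := (hasTop_hahnPoly m n k).1
    have : HasTop (hahnPoly m n k) ℓ 0 :=
      ⟨hk.trans h.le, Polynomial.coeff_eq_zero_of_natDegree_lt (hk.trans_lt h)⟩
    rw [sum_weight_hahnPoly_mul this]
    simp
  rcases h.lt_or_gt with h | h
  · rw [← key h]
    exact sum_congr rfl fun p _ => by ring
  · exact key h

/-- Restriction of a weighted sum to the support of the weight. -/
theorem sum_antidiagonal_weight {m n : ℕ} (h : 2 * m ≤ n) (f : ℕ → ℕ → ℝ) :
    ∑ p ∈ antidiagonal n, (p.1.choose m : ℝ) * p.2.choose m * f p.1 p.2 =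
      ∑ i ∈ range (n - 2 * m + 1), ((m + i).choose m : ℝ) * (n - (m + i)).choose m *
        f (m + i) (n - (m + i)) := by
  rw [Nat.sum_antidiagonal_eq_sum_range_succ_mk,
    show n.succ = m + (n - 2 * m + 1) + m by omega, sum_range_add, sum_range_add,
    sum_eq_zero (s := range m), sum_eq_zero (s := range m), zero_add, add_zero]
  · intro i hi
    have := mem_range.1 hi
    dsimp only
    rw [Nat.choose_eq_zero_of_lt (show n - (m + (n - 2 * m + 1) + i) < m by omega)]
    simp
  · intro i hi
    simp [Nat.choose_eq_zero_of_lt (mem_range.1 hi)]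

/-- Completeness of the Hahn polynomials. -/
theorem sum_hahnPoly_dual {m n i j : ℕ} (hi : m ≤ i) (hi' : i + m ≤ n) (hj : m ≤ j)
    (hj' : j + m ≤ n) :
    ∑ ℓ ∈ range (n - 2 * m + 1), (hahnPoly m n ℓ).eval (i : ℝ) *
      ((hahnPoly m n ℓ).eval (j : ℝ) * ((j.choose m : ℝ) * (n - j).choose m) / hahnNorm m n ℓ) =
      if i = j then 1 else 0 := by
  let A : Matrix (Fin (n - 2 * m + 1)) (Fin (n - 2 * m + 1)) ℝ := fun ℓ j =>
    (hahnPoly m n ℓ).eval ((m + j : ℕ) : ℝ) *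
      (((m + j).choose m : ℝ) * (n - (m + j)).choose m) / hahnNorm m n ℓ
  let B : Matrix (Fin (n - 2 * m + 1)) (Fin (n - 2 * m + 1)) ℝ := fun i ℓ =>
    (hahnPoly m n ℓ).eval ((m + i : ℕ) : ℝ)
  have hAB : A * B = 1 := by
    ext ℓ k
    have e : (A * B) ℓ k = (∑ p ∈ antidiagonal n, (p.1.choose m : ℝ) * p.2.choose m *
        (hahnPoly m n ℓ).eval (p.1 : ℝ) * (hahnPoly m n k).eval (p.1 : ℝ)) /
          hahnNorm m n ℓ := by
      simp only [mul_assoc _ (Polynomial.eval _ _) (Polynomial.eval _ _)]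
      rw [sum_antidiagonal_weight (by omega) (fun a _ =>
        (hahnPoly m n ℓ).eval (a : ℝ) * (hahnPoly m n k).eval (a : ℝ)), Matrix.mul_apply,
        Fin.sum_univ_eq_sum_range (fun j => (hahnPoly m n ℓ).eval ((m + j : ℕ) : ℝ) *
          (((m + j).choose m : ℝ) * (n - (m + j)).choose m) / hahnNorm m n ℓ *
          (hahnPoly m n k).eval ((m + j : ℕ) : ℝ)), sum_div]
      exact sum_congr rfl fun a _ => by ring
    rw [e, Matrix.one_apply]
    split_ifs with h
    · subst h
      rw [sum_weight_hahnPoly_sq, div_self (hahnNorm_pos (by omega)).ne']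
    · rw [sum_weight_hahnPoly_hahnPoly (fun h' => h (Fin.ext h')), zero_div]
  have hBA := mul_eq_one_comm.1 hAB
  obtain ⟨i, rfl⟩ := Nat.exists_eq_add_of_le hi
  obtain ⟨j, rfl⟩ := Nat.exists_eq_add_of_le hj
  have h := congrFun (congrFun hBA ⟨i, by omega⟩) ⟨j, by omega⟩
  rw [Matrix.mul_apply, Matrix.one_apply] at h
  rw [← Fin.sum_univ_eq_sum_range (fun ℓ => (hahnPoly m n ℓ).eval ((m + i : ℕ) : ℝ) *
      ((hahnPoly m n ℓ).eval ((m + j : ℕ) : ℝ) *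
        (((m + j).choose m : ℝ) * (n - (m + j)).choose m) / hahnNorm m n ℓ))]
  simpa [A, B] using h

theorem HasTop.succ {p : Polynomial ℝ} {d : ℕ} {a : ℝ} (hp : HasTop p d a) :
    HasTop p (d + 1) 0 :=
  ⟨hp.1.trans d.le_succ, Polynomial.coeff_eq_zero_of_natDegree_lt (hp.1.trans_lt d.lt_succ_self)⟩

theorem HasTop.exists_of_top_eq_zero {p : Polynomial ℝ} {d : ℕ} (hp : HasTop p (d + 1) 0) :
    ∃ c, HasTop p d c :=
  ⟨p.coeff d, Polynomial.natDegree_le_iff_coeff_eq_zero.2 fun k hk => by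
    rcases (Nat.succ_le_of_lt hk).eq_or_lt with h | h
    · rw [← h]; exact hp.2
    · exact Polynomial.coeff_eq_zero_of_natDegree_lt (hp.1.trans_lt h), rfl⟩

section Triangular

variable {α : Type*} (V : Finset α) (K : α → α → ℝ) (Φ : Polynomial ℝ →ₗ[ℝ] (α → ℝ)) (Λ : ℕ → ℝ)

/-- The kernel `K` acts on the functions `Φ q` triangularly in the degree of `q`, with diagonal
entries `Λ`. -/
def ActsTriangularly : Prop :=
  ∀ (d : ℕ) (q : Polynomial ℝ) (c : ℝ), HasTop q d c →
    ∃ q', HasTop q' d (Λ d * c) ∧ ∀ x ∈ V, ∑ y ∈ V, K x y * Φ q y = Φ q' x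

variable {V K Φ Λ}

theorem actsTriangularly_of_basis {b b' : ℕ → Polynomial ℝ} {u : ℕ → ℝ} (hu : ∀ r, u r ≠ 0)
    (hb : ∀ r, HasTop (b r) r (u r)) (hb' : ∀ r, HasTop (b' r) r (Λ r * u r))
    (hK : ∀ r, ∀ x ∈ V, ∑ y ∈ V, K x y * Φ (b r) y = Φ (b' r) x) :
    ActsTriangularly V K Φ Λ := by
  have hC : ∀ (c : ℝ) (p : Polynomial ℝ) (y : α), Φ (Polynomial.C c * p) y = c * Φ p y := by
    intro c p y
    rw [← Polynomial.smul_eq_C_mul, map_smul, Pi.smul_apply, smul_eq_mul]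
  have step : ∀ (d : ℕ) (q : Polynomial ℝ) (c : ℝ), HasTop q d c →
      (∃ r', HasTop r' d 0 ∧ ∀ x ∈ V,
        ∑ y ∈ V, K x y * Φ (q - Polynomial.C (c / u d) * b d) y = Φ r' x) →
      ∃ q', HasTop q' d (Λ d * c) ∧ ∀ x ∈ V, ∑ y ∈ V, K x y * Φ q y = Φ q' x := by
    rintro d q c - ⟨r', hr', hx⟩
    refine ⟨r' + Polynomial.C (c / u d) * b' d,
      (hr'.add ((hb' d).C_mul _)).of_eq (by have := hu d; field_simp; ring), fun x hxV => ?_⟩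
    rw [map_add, Pi.add_apply, ← hx x hxV, hC, ← hK d x hxV, mul_sum, ← sum_add_distrib]
    refine sum_congr rfl fun y _ => ?_
    rw [map_sub, Pi.sub_apply, hC]
    ring
  have top : ∀ (d : ℕ) (q : Polynomial ℝ) (c : ℝ), HasTop q d c →
      HasTop (q - Polynomial.C (c / u d) * b d) d 0 := fun d q c hq =>
    (hq.sub ((hb d).C_mul _)).of_eq (by have := hu d; field_simp; ring)
  intro d
  induction d with
  | zero =>
    intro q c hq
    refine step 0 q c hq ⟨0, ⟨by simp, by simp⟩, fun x _ => ?_⟩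
    have h := top 0 q c hq
    rw [Polynomial.eq_C_of_natDegree_le_zero h.1, h.2]
    simp
  | succ d ih =>
    intro q c hq
    obtain ⟨e, he⟩ := (top (d + 1) q c hq).exists_of_top_eq_zero
    obtain ⟨r', hr', hx⟩ := ih _ _ he
    exact step _ q c hq ⟨r', hr'.succ, hx⟩

/-- Orthogonal polynomials are eigenvectors of a reversible kernel acting triangularly. -/
theorem ActsTriangularly.eigenvector (hT : ActsTriangularly V K Φ Λ) {w : α → ℝ}
    (hw : ∀ x ∈ V, 0 < w x) (hrev : ∀ x ∈ V, ∀ y ∈ V, w x * K x y = w y * K y x)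
    {ℓ : ℕ} {p : Polynomial ℝ} {a : ℝ} (hp : HasTop p ℓ a)
    (horth : ∀ q, HasTop q ℓ 0 → ∑ x ∈ V, Φ p x * Φ q x * w x = 0) {x : α} (hx : x ∈ V) :
    ∑ y ∈ V, K x y * Φ p y = Λ ℓ * Φ p x := by
  obtain ⟨p', hp', hKp⟩ := hT ℓ p a hp
  have hr : HasTop (p' - Polynomial.C (Λ ℓ) * p) ℓ 0 :=
    (hp'.sub (hp.C_mul _)).of_eq (sub_self _)
  set r := p' - Polynomial.C (Λ ℓ) * p with hrdef
  have hΦr : ∀ x ∈ V, Φ r x = ∑ y ∈ V, K x y * Φ p y - Λ ℓ * Φ p x := by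
    intro x hx
    rw [hKp x hx, hrdef, map_sub, ← Polynomial.smul_eq_C_mul, map_smul, Pi.sub_apply,
      Pi.smul_apply, smul_eq_mul]
  obtain ⟨r', hr', hKr⟩ := hT ℓ r 0 hr
  rw [mul_zero] at hr'
  have hzero : ∑ x ∈ V, Φ r x * Φ r x * w x = 0 := by
    have e1 : ∑ x ∈ V, Φ r x * Φ r x * w x =
        ∑ x ∈ V, ∑ y ∈ V, w x * K x y * (Φ p y * Φ r x) -
          Λ ℓ * ∑ x ∈ V, Φ p x * Φ r x * w x := by
      rw [mul_sum, ← sum_sub_distrib]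
      refine sum_congr rfl fun x hx => ?_
      have h := hΦr x hx
      have h' : Φ r x * Φ r x * w x =
          (∑ y ∈ V, K x y * Φ p y - Λ ℓ * Φ p x) * (Φ r x * w x) := by rw [← h]; ring
      rw [h', sub_mul, sum_mul]
      congr 1
      · exact sum_congr rfl fun y _ => by ring
      · ring
    rw [e1, horth r hr, mul_zero, sub_zero, sum_comm, ← horth r' hr']
    refine sum_congr rfl fun y hy => ?_
    rw [← hKr y hy, mul_sum, sum_mul]
    refine sum_congr rfl fun x hx => ?_
    rw [hrev x hx y hy]
    ring
  have h0 := (sum_eq_zero_iff_of_nonneg (fun x hx =>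
    mul_nonneg (mul_self_nonneg (Φ r x)) (hw x hx).le)).1 hzero x hx
  have h1 : Φ r x = 0 := by
    rcases mul_eq_zero.1 h0 with h | h
    · exact mul_self_eq_zero.1 h
    · exact absurd h (hw x hx).ne'
  rw [hΦr x hx] at h1
  linarith

end Triangular

theorem card_mul_sum_powerset_mem {x : Finset ℕ} {e : ℕ} (he : e ∈ x) (φ : ℕ → ℝ) :
    (#x : ℝ) * ∑ A ∈ x.powerset, (if e ∈ A then φ #A else 0) = ∑ A ∈ x.powerset, #A * φ #A := by
  obtain ⟨x', hx', rfl⟩ : ∃ x', e ∉ x' ∧ insert e x' = x :=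
    ⟨x.erase e, notMem_erase e x, insert_erase he⟩
  rw [sum_powerset_apply_card (fun m => (m : ℝ) * φ m), sum_powerset_insert hx']
  have h0 : ∑ A ∈ x'.powerset, (if e ∈ A then φ #A else 0) = 0 :=
    sum_eq_zero fun A hA => if_neg fun h => hx' (mem_powerset.1 hA h)
  have h1 : ∑ A ∈ x'.powerset, (if e ∈ insert e A then φ #(insert e A) else 0) =
      ∑ A ∈ x'.powerset, φ (#A + 1) := by
    refine sum_congr rfl fun A hA => ?_
    rw [if_pos (mem_insert_self e A), card_insert_of_notMem fun h => hx' (mem_powerset.1 hA h)]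
  rw [h0, h1, zero_add, sum_powerset_apply_card (fun m => φ (m + 1)), card_insert_of_notMem hx',
    sum_range_succ' _ (#x' + 1), mul_sum]
  simp only [Nat.cast_zero, zero_mul, smul_zero, add_zero, nsmul_eq_mul]
  refine sum_congr rfl fun m _ => ?_
  have : ((#x' : ℝ) + 1) * (#x').choose m = (#x' + 1).choose (m + 1) * (m + 1) := by
    exact_mod_cast Nat.add_one_mul_choose_eq #x' m
  push_cast
  linear_combination φ (m + 1) * this

theorem sum_powerset_inter_sdiff {x I : Finset ℕ} (hx : x ⊆ I)
    (F : Finset ℕ → Finset ℕ → ℝ) :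
    ∑ y ∈ I.powerset, F (x ∩ y) (y \ x) =
      ∑ A ∈ x.powerset, ∑ B ∈ (I \ x).powerset, F A B := by
  rw [← sum_product']
  refine sum_nbij' (fun y => (x ∩ y, y \ x)) (fun p => p.1 ∪ p.2) ?_ ?_ ?_ ?_ ?_
  · intro y hy
    rw [mem_powerset] at hy
    simp only [mem_product, mem_powerset]
    exact ⟨inter_subset_left, sdiff_subset_sdiff hy subset_rfl⟩
  · intro p hp
    simp only [mem_product, mem_powerset] at hp ⊢
    exact union_subset (hp.1.trans hx) (hp.2.trans sdiff_subset)
  · intro y _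
    ext i
    simp only [mem_union, mem_inter, mem_sdiff]
    tauto
  · rintro ⟨A, B⟩ hp
    simp only [mem_product, mem_powerset] at hp
    have hB : ∀ i ∈ B, i ∉ x := fun i hi => (mem_sdiff.1 (hp.2 hi)).2
    have hA : ∀ i ∈ A, i ∈ x := fun i hi => hp.1 hi
    ext i
    · simp only [mem_union, mem_inter]
      have := hA i; have := hB i
      tauto
    · simp only [mem_union, mem_sdiff]
      have := hA i; have := hB i
      tauto
  · intro y _
    rfl

/-- The probability that one block of the Burnside chain moves to a given set of `a` among `j`
elements. -/
noncomputable def blockWeight (j a : ℕ) : ℝ :=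
  arcsineMoment a * arcsineMoment (j - a) / j.choose a

theorem sum_powerset_blockWeight_mul {α : Type*} (x : Finset α) (φ : ℕ → ℝ) :
    ∑ A ∈ x.powerset, blockWeight #x #A * φ #A =
      ∑ p ∈ antidiagonal #x, arcsineMoment p.1 * arcsineMoment p.2 * φ p.1 := by
  rw [sum_powerset_apply_card (fun m => blockWeight #x m * φ m),
    Nat.sum_antidiagonal_eq_sum_range_succ
      (fun a b => arcsineMoment a * arcsineMoment b * φ a) #x]
  refine sum_congr rfl fun m hm => ?_
  have : ((#x).choose m : ℝ) ≠ 0 := by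
    exact_mod_cast (Nat.choose_pos (Nat.lt_succ_iff.1 (mem_range.1 hm))).ne'
  rw [nsmul_eq_mul, blockWeight]
  field_simp

theorem Kmat_eq_blockWeight {n : ℕ} {x y : Finset ℕ} (hx : x ⊆ Icc 1 n) (hy : y ⊆ Icc 1 n) :
    Kmat n x y = blockWeight #x #(x ∩ y) * blockWeight (n - #x) #(y \ x) := by
  have h1 : #(x \ y) + #(x ∩ y) = #x := card_sdiff_add_card_inter x y
  have h2 : #(x ∪ y) = #x + #(y \ x) := by
    rw [← card_union_of_disjoint disjoint_sdiff, union_sdiff_self_eq_union]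
  have h3 : #(x ∪ y) ≤ n := by simpa using card_le_card (union_subset hx hy)
  unfold Kmat blockWeight
  generalize #(x \ y) = c at *
  generalize #(x ∩ y) = a at *
  generalize #(y \ x) = b at *
  obtain ⟨d, hd⟩ := Nat.exists_eq_add_of_le h3
  rw [h2, ← h1] at hd ⊢
  subst hd
  rw [show c + a + b + d - (c + a + b) = d by omega, show c + a + b + d - (c + a) = b + d by omega,
    show c + a - a = c by omega, show b + d - b = d by omega,
    Nat.choose_symm_add (a := c) (b := a), add_comm d b, Nat.choose_symm_add (a := b) (b := d)]
  simp only [arcsineMoment, Nat.centralBinom, pow_add]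
  field_simp

/-- The expectation of `F a b`, where `a` and `b` are independent and follow discrete arcsine laws
on `{0, …, j}` and `{0, …, k}`. -/
noncomputable def arcsineExp (j k : ℕ) (F : ℕ → ℕ → ℝ) : ℝ :=
  ∑ p ∈ antidiagonal j, ∑ q ∈ antidiagonal k,
    arcsineMoment p.1 * arcsineMoment p.2 * (arcsineMoment q.1 * arcsineMoment q.2) * F p.1 q.1

theorem arcsineExp_mul (j k : ℕ) (f g : ℕ → ℝ) :
    arcsineExp j k (fun a b => f a * g b) =
      (∑ p ∈ antidiagonal j, arcsineMoment p.1 * arcsineMoment p.2 * f p.1) *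
        ∑ q ∈ antidiagonal k, arcsineMoment q.1 * arcsineMoment q.2 * g q.1 := by
  rw [arcsineExp, sum_mul_sum]
  exact sum_congr rfl fun p _ => sum_congr rfl fun q _ => by ring

theorem arcsineExp_const_mul (j k : ℕ) (c : ℝ) (F : ℕ → ℕ → ℝ) :
    arcsineExp j k (fun a b => c * F a b) = c * arcsineExp j k F := by
  simp only [arcsineExp, mul_sum]
  exact sum_congr rfl fun p _ => sum_congr rfl fun q _ => by ring

theorem arcsineExp_sum (j k : ℕ) {ι : Type*} (s : Finset ι) (F : ι → ℕ → ℕ → ℝ) :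
    arcsineExp j k (fun a b => ∑ i ∈ s, F i a b) = ∑ i ∈ s, arcsineExp j k (F i) := by
  simp only [arcsineExp, mul_sum]
  rw [sum_congr rfl fun p _ => sum_comm, sum_comm]

theorem arcsineExp_choose_mul_choose (j k u v : ℕ) :
    arcsineExp j k (fun a b => (a.choose u : ℝ) * b.choose v) =
      j.choose u * arcsineMoment u * (k.choose v * arcsineMoment v) := by
  rw [arcsineExp_mul j k (fun a => (a.choose u : ℝ)) (fun b => (b.choose v : ℝ)),
    sum_arcsineMoment_mul_choose, sum_arcsineMoment_mul_choose]

section Kernel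

variable {n : ℕ} {x : Finset ℕ}

theorem sum_Kmat_mul (hx : x ⊆ Icc 1 n) (F : Finset ℕ → Finset ℕ → ℝ) :
    ∑ y ∈ (Icc 1 n).powerset, Kmat n x y * F (x ∩ y) (y \ x) =
      ∑ A ∈ x.powerset, ∑ B ∈ (Icc 1 n \ x).powerset,
        blockWeight #x #A * blockWeight (n - #x) #B * F A B := by
  rw [← sum_powerset_inter_sdiff hx
    (fun A B => blockWeight #x #A * blockWeight (n - #x) #B * F A B)]
  exact sum_congr rfl fun y hy => by rw [Kmat_eq_blockWeight hx (mem_powerset.1 hy)]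

theorem card_Icc_sdiff (hx : x ⊆ Icc 1 n) : #(Icc 1 n \ x) = n - #x := by
  simp [card_sdiff_of_subset hx]

theorem sum_Kmat_mul_card (hx : x ⊆ Icc 1 n) (F : ℕ → ℕ → ℝ) :
    ∑ y ∈ (Icc 1 n).powerset, Kmat n x y * F #(x ∩ y) #(y \ x) =
      arcsineExp #x (n - #x) F := by
  rw [sum_Kmat_mul hx (fun A B => F #A #B)]
  have h : ∀ A ∈ x.powerset, ∑ B ∈ (Icc 1 n \ x).powerset,
      blockWeight #x #A * blockWeight (n - #x) #B * F #A #B =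
      blockWeight #x #A * ∑ q ∈ antidiagonal (n - #x),
        arcsineMoment q.1 * arcsineMoment q.2 * F #A q.1 := by
    intro A _
    rw [← card_Icc_sdiff hx, ← sum_powerset_blockWeight_mul, mul_sum]
    exact sum_congr rfl fun B _ => by ring
  rw [sum_congr rfl h, sum_powerset_blockWeight_mul x (fun a => ∑ q ∈ antidiagonal (n - #x),
        arcsineMoment q.1 * arcsineMoment q.2 * F a q.1), arcsineExp]
  refine sum_congr rfl fun p _ => ?_
  rw [mul_sum]
  exact sum_congr rfl fun q _ => by ring

theorem card_mul_sum_Kmat_mem (hx : x ⊆ Icc 1 n) {e : ℕ} (he : e ∈ x) (F : ℕ → ℕ → ℝ) :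
    (#x : ℝ) * ∑ y ∈ (Icc 1 n).powerset, Kmat n x y *
        (if e ∈ y then F #(x ∩ y) #(y \ x) else 0) =
      arcsineExp #x (n - #x) (fun a b => a * F a b) := by
  rw [← sum_Kmat_mul_card hx, sum_Kmat_mul hx (fun A B => (#A : ℝ) * F #A #B), sum_comm]
  have h : ∑ y ∈ (Icc 1 n).powerset, Kmat n x y * (if e ∈ y then F #(x ∩ y) #(y \ x) else 0) =
      ∑ y ∈ (Icc 1 n).powerset, Kmat n x y *
        (if e ∈ x ∩ y then F #(x ∩ y) #(y \ x) else 0) :=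
    sum_congr rfl fun y _ => by simp [he]
  rw [h, sum_Kmat_mul hx (fun A B => if e ∈ A then F #A #B else 0), sum_comm, mul_sum]
  refine sum_congr rfl fun B _ => ?_
  have h := card_mul_sum_powerset_mem he
    (fun a => blockWeight #x a * blockWeight (n - #x) #B * F a #B)
  refine Eq.trans ?_ (h.trans ?_)
  · simp only [mul_ite, mul_zero]
  · exact sum_congr rfl fun A _ => by ring

theorem card_mul_sum_Kmat_mem_compl (hx : x ⊆ Icc 1 n) {e : ℕ} (he : e ∈ Icc 1 n \ x)
    (F : ℕ → ℕ → ℝ) :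
    ((n - #x : ℕ) : ℝ) * ∑ y ∈ (Icc 1 n).powerset, Kmat n x y *
        (if e ∈ y then F #(x ∩ y) #(y \ x) else 0) =
      arcsineExp #x (n - #x) (fun a b => b * F a b) := by
  rw [← sum_Kmat_mul_card hx, sum_Kmat_mul hx (fun A B => (#B : ℝ) * F #A #B)]
  have h : ∑ y ∈ (Icc 1 n).powerset, Kmat n x y * (if e ∈ y then F #(x ∩ y) #(y \ x) else 0) =
      ∑ y ∈ (Icc 1 n).powerset, Kmat n x y *
        (if e ∈ y \ x then F #(x ∩ y) #(y \ x) else 0) :=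
    sum_congr rfl fun y _ => by simp [(mem_sdiff.1 he).2]
  rw [h, sum_Kmat_mul hx (fun A B => if e ∈ B then F #A #B else 0), mul_sum]
  refine sum_congr rfl fun A _ => ?_
  have h := card_mul_sum_powerset_mem he
    (fun b => blockWeight #x #A * blockWeight (n - #x) b * F #A b)
  rw [card_Icc_sdiff hx] at h
  refine Eq.trans ?_ (h.trans ?_)
  · simp only [mul_ite, mul_zero]
  · exact sum_congr rfl fun B _ => by ring

theorem sum_Kmat (hx : x ⊆ Icc 1 n) : ∑ y ∈ (Icc 1 n).powerset, Kmat n x y = 1 := by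
  have h := sum_Kmat_mul_card hx (fun a b => (a.choose 0 : ℝ) * b.choose 0)
  rw [arcsineExp_choose_mul_choose] at h
  simpa [arcsineMoment_zero] using h

theorem piDist_pos (hx : x ⊆ Icc 1 n) : 0 < piDist n x := by
  have h : #x ≤ n := by simpa using card_le_card hx
  have : 0 < (n.choose #x : ℝ) := by exact_mod_cast Nat.choose_pos h
  unfold piDist
  positivity

theorem piDist_mul_Kmat {y : Finset ℕ} (hx : x ⊆ Icc 1 n) (hy : y ⊆ Icc 1 n) :
    piDist n x * Kmat n x y = piDist n y * Kmat n y x := by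
  have h1 : #(x \ y) + #(x ∩ y) = #x := card_sdiff_add_card_inter x y
  have h1' : #(y \ x) + #(x ∩ y) = #y := by rw [inter_comm]; exact card_sdiff_add_card_inter y x
  have h2 : #(x ∪ y) = #x + #(y \ x) := by
    rw [← card_union_of_disjoint disjoint_sdiff, union_sdiff_self_eq_union]
  have h3 : #(x ∪ y) ≤ n := by simpa using card_le_card (union_subset hx hy)
  unfold piDist Kmat
  rw [union_comm y x, inter_comm y x]
  generalize #(x \ y) = c at *
  generalize #(x ∩ y) = a at *
  generalize #(y \ x) = b at *
  obtain ⟨d, hd⟩ := Nat.exists_eq_add_of_le h3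
  rw [h2, ← h1] at hd ⊢
  rw [← h1']
  subst hd
  rw [show c + a + b + d - (c + a + b) = d by omega]
  have f1 : ((c + a + b + d).choose (c + a) : ℝ) = (c + a + b + d).factorial /
      ((c + a).factorial * (d + b).factorial) := by
    rw [Nat.cast_choose ℝ (by omega), show c + a + b + d - (c + a) = d + b by omega]
  have f2 : ((c + a + b + d).choose (b + a) : ℝ) = (c + a + b + d).factorial /
      ((b + a).factorial * (d + c).factorial) := by
    rw [Nat.cast_choose ℝ (by omega), show c + a + b + d - (b + a) = d + c by omega]
  rw [f1, f2, Nat.cast_add_choose, Nat.cast_add_choose, Nat.cast_add_choose, Nat.cast_add_choose]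
  field_simp

end Kernel

theorem cast_succ_mul_choose {f : Polynomial ℝ} {t : ℝ} {N : ℕ} (h : f.eval t = (N : ℝ) - 1)
    (u : ℕ) : ((u : ℝ) + 1) * N.choose (u + 1) = N * (binomPoly f u).eval t := by
  cases N with
  | zero => simp
  | succ N =>
    rw [eval_binomPoly f t N u (by rw [h]; simp)]
    have := Nat.add_one_mul_choose_eq N u
    push_cast
    have h' : ((N : ℝ) + 1) * N.choose u = (N + 1).choose (u + 1) * (u + 1) := by exact_mod_cast this
    linarith

theorem cast_mul_choose_add_sub_one (a b r : ℕ) :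
    (a : ℝ) * (binomPoly (Polynomial.X - Polynomial.C 1) r).eval ((a : ℝ) + b) =
      ∑ p ∈ antidiagonal r, ((p.1 : ℝ) + 1) * a.choose (p.1 + 1) * b.choose p.2 := by
  cases a with
  | zero => simp
  | succ a =>
    rw [eval_binomPoly _ _ (a + b) r (by simp; ring), Nat.add_choose_eq, Nat.cast_sum, mul_sum]
    refine sum_congr rfl fun p _ => ?_
    rw [cast_succ_mul_choose (f := Polynomial.X) (t := a) (by simp),
      eval_binomPoly _ _ a _ (by simp)]
    push_cast
    ring

theorem cast_mul_choose_add_sub_one' (a b r : ℕ) :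
    (b : ℝ) * (binomPoly (Polynomial.X - Polynomial.C 1) r).eval ((a : ℝ) + b) =
      ∑ p ∈ antidiagonal r, ((p.2 : ℝ) + 1) * (a.choose p.1 * b.choose (p.2 + 1)) := by
  rw [add_comm, cast_mul_choose_add_sub_one, ← Nat.sum_antidiagonal_swap]
  exact sum_congr rfl fun p _ => by simp only [Prod.fst_swap, Prod.snd_swap]; ring

/-- The linear map sending `p` to the function `y ↦ p(|y|) g(y)`. -/
noncomputable def radialMul (g : Finset ℕ → ℝ) : Polynomial ℝ →ₗ[ℝ] (Finset ℕ → ℝ) where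
  toFun p y := p.eval (#y : ℝ) * g y
  map_add' p q := by funext y; simp [add_mul]
  map_smul' c p := by funext y; simp [mul_assoc]

theorem radialMul_apply (g : Finset ℕ → ℝ) (p : Polynomial ℝ) (y : Finset ℕ) :
    radialMul g p y = p.eval (#y : ℝ) * g y := rfl

/-- The function `n 1[n ∈ y] - |y|`, orthogonal to all functions of `|y|`. -/
noncomputable def pointDeviation (n : ℕ) (y : Finset ℕ) : ℝ :=
  n * (if n ∈ y then 1 else 0) - #y

theorem card_inter_add_card_sdiff' (x y : Finset ℕ) : (#y : ℝ) = #(x ∩ y) + #(y \ x) := by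
  rw [inter_comm, add_comm]
  exact_mod_cast (card_sdiff_add_card_inter y x).symm

theorem cast_card_compl {n : ℕ} {x : Finset ℕ} (hx : x ⊆ Icc 1 n) :
    ((n - #x : ℕ) : ℝ) = n - #x :=
  Nat.cast_sub (by simpa using card_le_card hx)

theorem burnsideEigenvalue_mul_inv_factorial (r : ℕ) :
    burnsideEigenvalue r * (1 / r.factorial) = diffMoment r := by
  have : (r.factorial : ℝ) ≠ 0 := by positivity
  unfold burnsideEigenvalue
  field_simp

theorem actsTriangularly_radial (n : ℕ) :
    ActsTriangularly (Icc 1 n).powerset (Kmat n) (radialMul fun _ => 1) burnsideEigenvalue := by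
  refine actsTriangularly_of_basis (u := fun r => 1 / (r.factorial : ℝ))
    (b := fun r => binomPoly (Polynomial.X - Polynomial.C 0) r)
    (b' := fun r => ∑ p ∈ antidiagonal r,
      Polynomial.C (arcsineMoment p.1 * arcsineMoment p.2) *
        (binomPoly (Polynomial.X - Polynomial.C 0) p.1 *
          binomPoly (Polynomial.C (n : ℝ) - Polynomial.X) p.2))
    (fun r => by positivity)
    (fun r => (hasTop_binomPoly (hasTop_X_sub_C 0) r).of_eq (by rw [one_pow])) ?_ ?_
  · intro r
    rw [burnsideEigenvalue_mul_inv_factorial, diffMoment]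
    refine HasTop.sum fun p hp => ?_
    rw [← mem_antidiagonal.1 hp]
    refine ((hasTop_binomPoly_mul 0 n p.1 p.2).C_mul _).of_eq ?_
    unfold scaledMoment
    field_simp
  · intro r x hx
    rw [mem_powerset] at hx
    have h : ∀ y ∈ (Icc 1 n).powerset,
        Kmat n x y * radialMul (fun _ => 1) (binomPoly (Polynomial.X - Polynomial.C 0) r) y =
        Kmat n x y * (∑ p ∈ antidiagonal r, (#(x ∩ y)).choose p.1 * (#(y \ x)).choose p.2 : ℝ) := by
      intro y _
      rw [radialMul_apply, mul_one, card_inter_add_card_sdiff' x y,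
        eval_binomPoly _ _ (#(x ∩ y) + #(y \ x)) r (by simp), Nat.add_choose_eq]
      push_cast
      rfl
    rw [sum_congr rfl h, sum_Kmat_mul_card hx
      (fun a b => (∑ p ∈ antidiagonal r, (a.choose p.1) * (b.choose p.2) : ℝ)),
      arcsineExp_sum, radialMul_apply, mul_one, Polynomial.eval_finsetSum]
    refine sum_congr rfl fun p _ => ?_
    rw [arcsineExp_choose_mul_choose, Polynomial.eval_mul, Polynomial.eval_mul, Polynomial.eval_C,
      eval_binomPoly _ _ #x _ (by simp), eval_binomPoly _ _ (n - #x) _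
        (by rw [cast_card_compl hx]; simp)]
    ring

theorem actsTriangularly_pointDeviation {n : ℕ} (hn : 1 ≤ n) :
    ActsTriangularly (Icc 1 n).powerset (Kmat n) (radialMul (pointDeviation n))
      (fun r => burnsideEigenvalue (r + 1)) := by
  refine actsTriangularly_of_basis (u := fun r => 1 / (r.factorial : ℝ))
    (b := fun r => binomPoly (Polynomial.X - Polynomial.C 1) r)
    (b' := fun r => ∑ p ∈ antidiagonal r,
      (Polynomial.C (arcsineMoment (p.1 + 1) * arcsineMoment p.2) *
        (binomPoly (Polynomial.X - Polynomial.C 1) p.1 *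
          binomPoly (Polynomial.C (n : ℝ) - Polynomial.X) p.2) -
      Polynomial.C (arcsineMoment p.1 * arcsineMoment (p.2 + 1)) *
        (binomPoly (Polynomial.X - Polynomial.C 0) p.1 *
          binomPoly (Polynomial.C ((n : ℝ) - 1) - Polynomial.X) p.2)))
    (fun r => by positivity)
    (fun r => (hasTop_binomPoly (hasTop_X_sub_C 1) r).of_eq (by rw [one_pow])) ?_ ?_
  · intro r
    have e : burnsideEigenvalue (r + 1) * (1 / r.factorial) = (r + 1) * diffMoment (r + 1) := by
      have : (r.factorial : ℝ) ≠ 0 := by positivity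
      rw [burnsideEigenvalue, Nat.factorial_succ]
      push_cast
      field_simp
    have e' : ((r : ℝ) + 1) * diffMoment (r + 1) = ∑ p ∈ antidiagonal r,
        ((-1) ^ p.2 * ((p.1 : ℝ) + 1) * scaledMoment (p.1 + 1) * scaledMoment p.2 -
          (-1) ^ p.2 * ((p.2 : ℝ) + 1) * scaledMoment p.1 * scaledMoment (p.2 + 1)) := by
      have h : ((r : ℝ) + 1) * diffMoment (r + 1) =
          ∑ p ∈ antidiagonal (r + 1),
            (p.1 : ℝ) * ((-1) ^ p.2 * scaledMoment p.1 * scaledMoment p.2) +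
          ∑ p ∈ antidiagonal (r + 1),
            (p.2 : ℝ) * ((-1) ^ p.2 * scaledMoment p.1 * scaledMoment p.2) := by
        rw [diffMoment, mul_sum, ← sum_add_distrib]
        refine sum_congr rfl fun p hp => ?_
        have : (p.1 : ℝ) + p.2 = r + 1 := by exact_mod_cast mem_antidiagonal.1 hp
        rw [← this]
        ring
      rw [h, Nat.sum_antidiagonal_succ, Nat.sum_antidiagonal_succ' (n := r)]
      simp only [Nat.cast_zero, zero_mul, zero_add]
      rw [← sum_add_distrib]
      refine sum_congr rfl fun p _ => ?_
      push_cast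
      ring
    rw [e, e']
    refine HasTop.sum fun p hp => ?_
    rw [← mem_antidiagonal.1 hp]
    refine (((hasTop_binomPoly_mul 1 n p.1 p.2).C_mul _).sub
      ((hasTop_binomPoly_mul 0 ((n : ℝ) - 1) p.1 p.2).C_mul _)).of_eq ?_
    unfold scaledMoment
    rw [Nat.factorial_succ, Nat.factorial_succ]
    push_cast
    field_simp
  · intro r x hx
    rw [mem_powerset] at hx
    set q := binomPoly (Polynomial.X - Polynomial.C (1 : ℝ)) r with hq
    set F : ℕ → ℕ → ℝ := fun a b => q.eval ((a : ℝ) + b) with hF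
    set P : ℝ := ∑ p ∈ antidiagonal r, arcsineMoment (p.1 + 1) * arcsineMoment p.2 *
        ((binomPoly (Polynomial.X - Polynomial.C 1) p.1).eval (#x : ℝ) *
          (binomPoly (Polynomial.C (n : ℝ) - Polynomial.X) p.2).eval (#x : ℝ)) with hP
    set Q : ℝ := ∑ p ∈ antidiagonal r, arcsineMoment p.1 * arcsineMoment (p.2 + 1) *
        ((binomPoly (Polynomial.X - Polynomial.C 0) p.1).eval (#x : ℝ) *
          (binomPoly (Polynomial.C ((n : ℝ) - 1) - Polynomial.X) p.2).eval (#x : ℝ)) with hQ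
    have hSa : arcsineExp #x (n - #x) (fun a b => a * F a b) = #x * P := by
      simp only [hF, hq, cast_mul_choose_add_sub_one, mul_assoc]
      rw [arcsineExp_sum, hP, mul_sum]
      refine sum_congr rfl fun p _ => ?_
      rw [arcsineExp_const_mul, arcsineExp_choose_mul_choose,
        eval_binomPoly (Polynomial.C (n : ℝ) - Polynomial.X) _ (n - #x) _
          (by rw [cast_card_compl hx]; simp)]
      linear_combination arcsineMoment (p.1 + 1) * arcsineMoment p.2 * ((n - #x).choose p.2 : ℝ) *
        cast_succ_mul_choose (f := Polynomial.X - Polynomial.C 1) (t := #x) (N := #x) (by simp) p.1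
    have hSb : arcsineExp #x (n - #x) (fun a b => b * F a b) = (n - #x : ℕ) * Q := by
      simp only [hF, hq, cast_mul_choose_add_sub_one']
      rw [arcsineExp_sum, hQ, mul_sum]
      refine sum_congr rfl fun p _ => ?_
      rw [arcsineExp_const_mul, arcsineExp_choose_mul_choose,
        eval_binomPoly (Polynomial.X - Polynomial.C 0) _ #x _ (by simp)]
      linear_combination arcsineMoment p.1 * arcsineMoment (p.2 + 1) * ((#x).choose p.1 : ℝ) *
        cast_succ_mul_choose (f := Polynomial.C ((n : ℝ) - 1) - Polynomial.X) (t := #x)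
          (N := n - #x) (by rw [cast_card_compl hx]; simp; ring) p.2
    have hR : (radialMul (pointDeviation n)) (∑ p ∈ antidiagonal r,
        (Polynomial.C (arcsineMoment (p.1 + 1) * arcsineMoment p.2) *
          (binomPoly (Polynomial.X - Polynomial.C 1) p.1 *
            binomPoly (Polynomial.C (n : ℝ) - Polynomial.X) p.2) -
        Polynomial.C (arcsineMoment p.1 * arcsineMoment (p.2 + 1)) *
          (binomPoly (Polynomial.X - Polynomial.C 0) p.1 *
            binomPoly (Polynomial.C ((n : ℝ) - 1) - Polynomial.X) p.2))) x =
        (P - Q) * pointDeviation n x := by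
      rw [radialMul_apply, sum_sub_distrib, Polynomial.eval_sub, Polynomial.eval_finsetSum,
        Polynomial.eval_finsetSum]
      simp only [Polynomial.eval_mul, Polynomial.eval_C]
      rw [hP, hQ]
    have hL : ∑ y ∈ (Icc 1 n).powerset, Kmat n x y * radialMul (pointDeviation n) q y =
        n * ∑ y ∈ (Icc 1 n).powerset, Kmat n x y * (if n ∈ y then F #(x ∩ y) #(y \ x) else 0) -
          #x * P - (n - #x : ℕ) * Q := by
      rw [← hSa, ← hSb, ← sum_Kmat_mul_card hx, ← sum_Kmat_mul_card hx, mul_sum,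
        ← sum_sub_distrib, ← sum_sub_distrib]
      refine sum_congr rfl fun y _ => ?_
      rw [radialMul_apply, pointDeviation, card_inter_add_card_sdiff' x y]
      split_ifs <;> simp only [hF] <;> ring
    rw [hR, hL, pointDeviation]
    set M := ∑ y ∈ (Icc 1 n).powerset, Kmat n x y * (if n ∈ y then F #(x ∩ y) #(y \ x) else 0)
    have hc := cast_card_compl hx
    by_cases hnx : n ∈ x
    · have hM : M = P := by
        have h0 : (#x : ℝ) ≠ 0 := by exact_mod_cast (card_pos.2 ⟨n, hnx⟩).ne'
        refine mul_left_cancel₀ h0 ?_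
        rw [← hSa]
        exact card_mul_sum_Kmat_mem hx hnx F
      rw [if_pos hnx, hM, hc]
      ring
    · have hM : M = Q := by
        have hmem : n ∈ Icc 1 n \ x := mem_sdiff.2 ⟨mem_Icc.2 ⟨hn, le_rfl⟩, hnx⟩
        have h0 : ((n - #x : ℕ) : ℝ) ≠ 0 := by
          rw [← card_Icc_sdiff hx]
          exact_mod_cast (card_pos.2 ⟨n, hmem⟩).ne'
        refine mul_left_cancel₀ h0 ?_
        rw [← hSb]
        exact card_mul_sum_Kmat_mem_compl hx hmem F
      rw [if_neg hnx, hM, hc]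
      ring

theorem sum_powerset_mul_piDist (n : ℕ) (φ : ℕ → ℝ) :
    ∑ y ∈ (Icc 1 n).powerset, φ #y * piDist n y =
      1 / (n + 1) * ∑ p ∈ antidiagonal n, φ p.1 := by
  unfold piDist
  rw [sum_powerset_apply_card (fun m => φ m * (1 / ((n + 1) * (n.choose m : ℝ)))),
    Nat.sum_antidiagonal_eq_sum_range_succ (fun a _ => φ a) n, Nat.card_Icc, Nat.add_sub_cancel,
    mul_sum]
  refine sum_congr rfl fun m hm => ?_
  have : (n.choose m : ℝ) ≠ 0 := by
    exact_mod_cast (Nat.choose_pos (Nat.lt_succ_iff.1 (mem_range.1 hm))).ne'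
  rw [nsmul_eq_mul]
  field_simp

theorem sum_piDist (n : ℕ) : ∑ y ∈ (Icc 1 n).powerset, piDist n y = 1 := by
  have h := sum_powerset_mul_piDist n (fun _ => 1)
  simp only [one_mul, sum_const, Nat.card_antidiagonal, nsmul_eq_mul, mul_one] at h
  rw [h]
  push_cast
  field_simp

theorem inner_pointDeviation {n : ℕ} (hn : 1 ≤ n) (φ : ℕ → ℝ) :
    ∑ y ∈ (Icc 1 n).powerset, φ #y * pointDeviation n y ^ 2 * piDist n y =
      1 / (n + 1) * ∑ p ∈ antidiagonal n, (p.1 : ℝ) * p.2 * φ p.1 := by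
  have hmem : n ∈ Icc 1 n := mem_Icc.2 ⟨hn, le_rfl⟩
  have h := card_mul_sum_powerset_mem hmem
    (fun m => ((n : ℝ) - 2 * m) * φ m * (1 / ((n + 1) * (n.choose m : ℝ))))
  rw [Nat.card_Icc, Nat.add_sub_cancel, mul_sum] at h
  have e : ∑ y ∈ (Icc 1 n).powerset, φ #y * pointDeviation n y ^ 2 * piDist n y =
      ∑ y ∈ (Icc 1 n).powerset, ((#y : ℝ) * (n - #y) * φ #y) * piDist n y := by
    rw [← sub_eq_zero, ← sum_sub_distrib]
    rw [← sub_eq_zero, ← sum_sub_distrib] at h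
    rw [← h]
    refine sum_congr rfl fun y _ => ?_
    unfold pointDeviation piDist
    split_ifs <;> ring
  rw [e, sum_powerset_mul_piDist n (fun m => (m : ℝ) * (n - m) * φ m)]
  congr 1
  refine sum_congr rfl fun p hp => ?_
  have : (p.1 : ℝ) + p.2 = n := by exact_mod_cast mem_antidiagonal.1 hp
  rw [← this]
  ring

section Spectral

variable {n : ℕ} {x y : Finset ℕ}

theorem sum_Kmat_mul_radial_hahnPoly (hx : x ∈ (Icc 1 n).powerset) (ℓ : ℕ) :
    ∑ y ∈ (Icc 1 n).powerset, Kmat n x y * radialMul (fun _ => 1) (hahnPoly 0 n ℓ) y =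
      burnsideEigenvalue ℓ * radialMul (fun _ => 1) (hahnPoly 0 n ℓ) x := by
  refine (actsTriangularly_radial n).eigenvector (w := piDist n)
    (fun x hx => piDist_pos (mem_powerset.1 hx))
    (fun x hx y hy => piDist_mul_Kmat (mem_powerset.1 hx) (mem_powerset.1 hy))
    (hasTop_hahnPoly 0 n ℓ) (fun q hq => ?_) hx
  have h := sum_weight_hahnPoly_mul hq 0 n
  simp only [radialMul_apply, mul_one]
  rw [sum_powerset_mul_piDist n
    (fun m => (hahnPoly 0 n ℓ).eval (m : ℝ) * q.eval (m : ℝ))]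
  simp only [Nat.choose_zero_right, Nat.cast_one, one_mul, mul_zero] at h
  rw [h, mul_zero]

theorem sum_Kmat_mul_pointDeviation_hahnPoly (hn : 1 ≤ n) (hx : x ∈ (Icc 1 n).powerset) (ℓ : ℕ) :
    ∑ y ∈ (Icc 1 n).powerset, Kmat n x y * radialMul (pointDeviation n) (hahnPoly 1 n ℓ) y =
      burnsideEigenvalue (ℓ + 1) * radialMul (pointDeviation n) (hahnPoly 1 n ℓ) x := by
  refine (actsTriangularly_pointDeviation hn).eigenvector (w := piDist n)
    (fun x hx => piDist_pos (mem_powerset.1 hx))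
    (fun x hx y hy => piDist_mul_Kmat (mem_powerset.1 hx) (mem_powerset.1 hy))
    (hasTop_hahnPoly 1 n ℓ) (fun q hq => ?_) hx
  have h := sum_weight_hahnPoly_mul hq 1 n
  have e := inner_pointDeviation hn
    (fun m => (hahnPoly 1 n ℓ).eval (m : ℝ) * q.eval (m : ℝ))
  simp only [Nat.choose_one_right, mul_zero, mul_assoc] at h
  simp only [mul_assoc] at e
  rw [h, mul_zero] at e
  rw [← e]
  refine sum_congr rfl fun y _ => ?_
  rw [radialMul_apply, radialMul_apply]
  ring

theorem Kpow_succ (s : ℕ) :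
    Kpow n (s + 1) x y = ∑ z ∈ (Icc 1 n).powerset, Kmat n x z * Kpow n s z y := rfl

theorem Kpow_singleton (hn : 2 ≤ n) (t : ℕ) (hx : x ∈ (Icc 1 n).powerset) :
    Kpow n t x {n} =
      1 / n * ∑ ℓ ∈ range (n + 1), burnsideEigenvalue ℓ ^ t *
          ((hahnPoly 0 n ℓ).eval 1 / hahnNorm 0 n ℓ *
            radialMul (fun _ => 1) (hahnPoly 0 n ℓ) x) +
      (n - 1) / n * ∑ ℓ ∈ range (n - 1), burnsideEigenvalue (ℓ + 1) ^ t *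
          ((hahnPoly 1 n ℓ).eval 1 / hahnNorm 1 n ℓ *
            radialMul (pointDeviation n) (hahnPoly 1 n ℓ) x) := by
  induction t generalizing x with
  | zero =>
    simp only [pow_zero, one_mul, Kpow]
    have hx' := mem_powerset.1 hx
    have hcard : #x ≤ n := by simpa using card_le_card hx'
    have h0 : ∑ ℓ ∈ range (n + 1), (hahnPoly 0 n ℓ).eval 1 / hahnNorm 0 n ℓ *
        radialMul (fun _ => 1) (hahnPoly 0 n ℓ) x = if #x = 1 then 1 else 0 := by
      rw [← sum_hahnPoly_dual (m := 0) (n := n) (i := #x) (j := 1) (by omega) (by omega)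
        (by omega) (by omega)]
      refine sum_congr rfl fun ℓ _ => ?_
      rw [radialMul_apply]
      simp only [Nat.choose_zero_right, Nat.cast_one]
      ring
    have h1 : (n - 1) * ∑ ℓ ∈ range (n - 1), (hahnPoly 1 n ℓ).eval 1 / hahnNorm 1 n ℓ *
        radialMul (pointDeviation n) (hahnPoly 1 n ℓ) x =
        (if #x = 1 then 1 else 0) * pointDeviation n x := by
      by_cases hends : 1 ≤ #x ∧ #x + 1 ≤ n
      · rw [← sum_hahnPoly_dual (m := 1) (n := n) (i := #x) (j := 1) hends.1 hends.2
          (by omega) (by omega), mul_sum, sum_mul, show n - 2 * 1 + 1 = n - 1 by omega]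
        refine sum_congr rfl fun ℓ _ => ?_
        rw [radialMul_apply, Nat.choose_self, Nat.choose_one_right, Nat.cast_sub (by omega)]
        push_cast
        ring
      · have hg : pointDeviation n x = 0 := by
          rcases Nat.eq_zero_or_pos #x with h | h
          · rw [card_eq_zero] at h
            simp [pointDeviation, h]
          · have hxI : x = Icc 1 n :=
              eq_of_subset_of_card_le hx' (by rw [Nat.card_Icc]; omega)
            have : n ∈ Icc 1 n := mem_Icc.2 ⟨by omega, le_rfl⟩
            rw [pointDeviation, hxI, if_pos this]
            simp
        simp [radialMul_apply, hg]
    have hn0 : (n : ℝ) ≠ 0 := by positivity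
    rw [h0, div_mul_eq_mul_div ((n : ℝ) - 1), h1, pointDeviation]
    by_cases hcx : #x = 1
    · obtain ⟨a, rfl⟩ := card_eq_one.1 hcx
      by_cases ha : a = n
      · subst ha
        simp
        field_simp
        ring
      · have ha' : n ≠ a := fun h => ha h.symm
        simp [ha, ha']
        field_simp
        ring
    · have : x ≠ {n} := fun h => hcx (by rw [h, card_singleton])
      simp [hcx, this]
  | succ t ih =>
    have e : ∀ z ∈ (Icc 1 n).powerset, Kmat n x z * Kpow n t z {n} =
        1 / n * ∑ ℓ ∈ range (n + 1), burnsideEigenvalue ℓ ^ t *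
          ((hahnPoly 0 n ℓ).eval 1 / hahnNorm 0 n ℓ *
            (Kmat n x z * radialMul (fun _ => 1) (hahnPoly 0 n ℓ) z)) +
        (n - 1) / n * ∑ ℓ ∈ range (n - 1), burnsideEigenvalue (ℓ + 1) ^ t *
          ((hahnPoly 1 n ℓ).eval 1 / hahnNorm 1 n ℓ *
            (Kmat n x z * radialMul (pointDeviation n) (hahnPoly 1 n ℓ) z)) := by
      intro z hz
      rw [ih hz, mul_add, mul_left_comm, mul_left_comm (Kmat n x z), mul_sum (a := Kmat n x z),
        mul_sum (a := Kmat n x z)]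
      congr 2 <;> exact sum_congr rfl fun ℓ _ => by ring
    rw [Kpow_succ, sum_congr rfl e, sum_add_distrib, ← mul_sum, ← mul_sum, sum_comm,
      sum_comm (s := (Icc 1 n).powerset)]
    congr 2
    · refine sum_congr rfl fun ℓ _ => ?_
      rw [← mul_sum, ← mul_sum, sum_Kmat_mul_radial_hahnPoly hx]
      ring
    · refine sum_congr rfl fun ℓ _ => ?_
      rw [← mul_sum, ← mul_sum, sum_Kmat_mul_pointDeviation_hahnPoly (by omega) hx]
      ring

theorem Kpow_add (s t : ℕ) (hx : x ∈ (Icc 1 n).powerset) :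
    Kpow n (s + t) x y = ∑ z ∈ (Icc 1 n).powerset, Kpow n s x z * Kpow n t z y := by
  induction s generalizing x with
  | zero =>
    simp only [Kpow, zero_add, ite_mul, one_mul, zero_mul]
    rw [sum_ite_eq, if_pos hx]
  | succ s ih =>
    rw [show s + 1 + t = s + t + 1 by ring, Kpow_succ]
    simp only [Kpow_succ, sum_mul]
    rw [sum_comm]
    refine sum_congr rfl fun w hw => ?_
    rw [ih hw, mul_sum]
    exact sum_congr rfl fun z _ => by ring

theorem Kpow_one (hy : y ∈ (Icc 1 n).powerset) : Kpow n 1 x y = Kmat n x y := by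
  simp only [Kpow, mul_ite, mul_one, mul_zero]
  rw [sum_ite_eq', if_pos hy]

theorem piDist_mul_Kpow (s : ℕ) (hx : x ∈ (Icc 1 n).powerset) (hy : y ∈ (Icc 1 n).powerset) :
    piDist n x * Kpow n s x y = piDist n y * Kpow n s y x := by
  induction s generalizing x with
  | zero =>
    by_cases h : x = y
    · rw [h]
    · simp [Kpow, h, Ne.symm h]
  | succ s ih =>
    rw [Kpow_add s 1 hy, Kpow_succ, mul_sum, mul_sum]
    refine sum_congr rfl fun z hz => ?_
    rw [Kpow_one hx, ← mul_assoc, ← mul_assoc, ← ih hz,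
      piDist_mul_Kmat (mem_powerset.1 hx) (mem_powerset.1 hz)]
    ring

theorem sum_Kpow (s : ℕ) (hx : x ∈ (Icc 1 n).powerset) :
    ∑ y ∈ (Icc 1 n).powerset, Kpow n s x y = 1 := by
  induction s generalizing x with
  | zero =>
    simp only [Kpow]
    rw [sum_ite_eq, if_pos hx]
  | succ s ih =>
    simp only [Kpow]
    rw [sum_comm, ← sum_Kmat (mem_powerset.1 hx)]
    refine sum_congr rfl fun z hz => ?_
    rw [← mul_sum, ih hz, mul_one]

/-- The chi-square distance of a reversible chain in terms of the return probability. -/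
theorem chiSq_eq_return (s : ℕ) (hx : x ∈ (Icc 1 n).powerset) :
    chiSq n s x = Kpow n (2 * s) x x / piDist n x - 1 := by
  have e : ∀ y ∈ (Icc 1 n).powerset, (Kpow n s x y - piDist n y) ^ 2 / piDist n y =
      Kpow n s x y * Kpow n s y x / piDist n x - 2 * Kpow n s x y + piDist n y := by
    intro y hy
    have h1 := piDist_pos (mem_powerset.1 hx)
    have h2 := piDist_pos (mem_powerset.1 hy)
    have h3 := piDist_mul_Kpow s hx hy
    field_simp
    linear_combination (Kpow n s x y) * h3
  rw [chiSq, sum_congr rfl e, sum_add_distrib, sum_sub_distrib, ← mul_sum, sum_Kpow s hx,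
    sum_piDist, ← sum_div, two_mul s, Kpow_add s s hx]
  ring

theorem chiSq_singleton (hn : 2 ≤ n) (s : ℕ) :
    chiSq n s {n} =
      (∑ ℓ ∈ range (n + 1), burnsideEigenvalue ℓ ^ (2 * s) *
        ((hahnPoly 0 n ℓ).eval 1 ^ 2 * (n + 1) / hahnNorm 0 n ℓ)) - 1 +
      ∑ ℓ ∈ range (n - 1), burnsideEigenvalue (ℓ + 1) ^ (2 * s) *
        ((hahnPoly 1 n ℓ).eval 1 ^ 2 * ((n - 1) ^ 2 * (n + 1)) / hahnNorm 1 n ℓ) := by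
  have hx : {n} ∈ (Icc 1 n).powerset := by
    rw [mem_powerset, singleton_subset_iff, mem_Icc]
    omega
  have hn0 : (n : ℝ) ≠ 0 := by positivity
  have hg : pointDeviation n {n} = n - 1 := by simp [pointDeviation]
  rw [chiSq_eq_return s hx, Kpow_singleton hn _ hx, piDist]
  simp only [radialMul_apply, card_singleton, Nat.cast_one, Nat.choose_one_right, hg, mul_one]
  rw [div_div_eq_mul_div, div_one, add_mul, mul_sum, mul_sum, sum_mul, sum_mul, add_sub_right_comm]
  congr 1
  · congr 1
    refine sum_congr rfl fun ℓ _ => ?_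
    field_simp
  · refine sum_congr rfl fun ℓ _ => ?_
    field_simp

end Spectral

theorem eval_hahnPoly_zero_one {n : ℕ} (hn : 1 ≤ n) (ℓ : ℕ) :
    (hahnPoly 0 n ℓ).eval 1 = ((n - 1).choose ℓ : ℝ) - ℓ * (n - 1).choose (ℓ - 1) := by
  obtain ⟨j, rfl⟩ := Nat.exists_eq_add_of_le hn
  have h := eval_hahnPoly 0 1 j ℓ
  rw [show 0 + 1 + (0 + j) = 1 + j by ring, zero_add, Nat.cast_one] at h
  rw [h, Nat.add_sub_cancel_left]
  cases ℓ with
  | zero => simp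
  | succ ℓ =>
    rw [Nat.sum_antidiagonal_succ, sum_eq_single (0, ℓ)]
    · simp
      ring
    · rintro ⟨a, b⟩ hab hne
      have ha : a ≠ 0 := by
        rintro rfl
        exact hne (by simpa using hab)
      rw [Nat.choose_eq_zero_of_lt (show 1 < a + 1 by omega)]
      simp
    · intro h
      exact absurd (mem_antidiagonal.2 (zero_add ℓ)) h

theorem eval_hahnPoly_one_one {n : ℕ} (hn : 2 ≤ n) (ℓ : ℕ) :
    (hahnPoly 1 n ℓ).eval 1 = (2 + ℓ : ℝ) * (n - 2).choose ℓ := by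
  obtain ⟨j, rfl⟩ := Nat.exists_eq_add_of_le hn
  have h := eval_hahnPoly 1 0 j ℓ
  rw [show 1 + 0 + (1 + j) = 2 + j by ring, add_zero, Nat.cast_one] at h
  rw [h, Nat.add_sub_cancel_left, sum_eq_single (0, ℓ)]
  · simp
  · rintro ⟨a, b⟩ hab hne
    have ha : a ≠ 0 := by
      rintro rfl
      exact hne (by simpa using hab)
    rw [Nat.choose_eq_zero_of_lt (show 0 < a by omega)]
    simp
  · intro h
    exact absurd (mem_antidiagonal.2 (zero_add ℓ)) h

theorem prod_Icc_add {n a : ℕ} (h : a ≤ n) (b : ℕ) :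
    ∏ i ∈ Icc (-(a : ℤ) + 1) (b : ℤ), ((n : ℝ) + (i : ℝ)) =
      (n + b).factorial / (n - a).factorial := by
  have e : ∏ i ∈ Icc (-(a : ℤ) + 1) (b : ℤ), ((n : ℝ) + (i : ℝ)) =
      ∏ k ∈ range (a + b), (((n - a + 1 + k : ℕ)) : ℝ) := by
    symm
    refine prod_nbij' (fun k => -(a : ℤ) + 1 + k) (fun i => (i + a - 1).toNat) ?_ ?_ ?_ ?_ ?_
    · intro k hk
      simp only [mem_range, mem_Icc] at hk ⊢
      omega
    · intro i hi
      simp only [mem_range, mem_Icc] at hi ⊢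
      omega
    · intro k _
      omega
    · intro i hi
      simp only [mem_Icc] at hi
      omega
    · intro k _
      push_cast [Nat.cast_sub h]
      ring
  have hf : ((n - a).factorial : ℝ) ≠ 0 := by positivity
  rw [e, ← Nat.cast_prod, ← Nat.ascFactorial_eq_prod_range, eq_div_iff hf, ← Nat.cast_mul,
    mul_comm, Nat.factorial_mul_ascFactorial, show n - a + (a + b) = n + b by omega]

theorem hahnNorm_zero {n ℓ : ℕ} (h : ℓ ≤ n) :
    hahnNorm 0 n ℓ = (∏ i ∈ Icc (-(ℓ : ℤ) + 1) ((ℓ : ℤ) + 1), ((n : ℝ) + (i : ℝ))) /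
      ((2 * ℓ + 1) * (ℓ.factorial : ℝ) ^ 2) := by
  have hp := prod_Icc_add h (ℓ + 1)
  push_cast at hp
  rw [hp, hahnNorm, rodriguesConst, Nat.cast_choose ℝ (by omega), Nat.cast_choose ℝ (by omega),
    show n + ℓ + 1 - (2 * 0 + 2 * ℓ + 1) = n - ℓ by omega,
    show 2 * 0 + 2 * ℓ - (0 + ℓ) = ℓ by omega]
  simp only [mul_zero, zero_add]
  rw [Nat.factorial_succ (2 * ℓ), Nat.factorial_zero, ← add_assoc]
  push_cast
  field_simp

theorem hahnNorm_one {n ℓ : ℕ} (h : ℓ + 2 ≤ n) :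
    hahnNorm 1 n ℓ =
      ((ℓ + 2) * ∏ i ∈ Icc (-(ℓ : ℤ) - 1) ((ℓ : ℤ) + 1), ((n : ℝ) + (i : ℝ))) /
        ((ℓ + 1) * (2 * ℓ + 3) * (ℓ.factorial : ℝ) ^ 2) := by
  have hp := prod_Icc_add h (ℓ + 1)
  push_cast at hp
  rw [show -((ℓ : ℤ) + 2) + 1 = -ℓ - 1 by ring] at hp
  rw [hp, hahnNorm, rodriguesConst, Nat.cast_choose ℝ (by omega), Nat.cast_choose ℝ (by omega),
    show n + ℓ + 1 - (2 * 1 + 2 * ℓ + 1) = n - (ℓ + 2) by omega,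
    show 2 * 1 + 2 * ℓ - (1 + ℓ) = ℓ + 1 by omega, show 2 * 1 + 2 * ℓ + 1 = 2 * ℓ + 2 + 1 by ring,
    show 2 * 1 + 2 * ℓ = 2 * ℓ + 2 by ring, show 2 * 1 + ℓ = ℓ + 1 + 1 by ring, add_comm 1 ℓ]
  rw [Nat.factorial_succ (2 * ℓ + 2), Nat.factorial_one, Nat.factorial_succ (ℓ + 1),
    Nat.factorial_succ ℓ, ← add_assoc]
  push_cast
  field_simp
  ring

theorem burnsideEigenvalue_two_mul (t : ℕ) : burnsideEigenvalue (2 * t) = betaEV t := by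
  rw [burnsideEigenvalue, factorial_mul_diffMoment_two_mul, arcsineMoment, betaEV, div_pow,
    ← pow_mul, mul_comm t 2, pow_mul, Nat.centralBinom]
  norm_num

theorem burnsideEigenvalue_of_odd {r : ℕ} (hr : Odd r) : burnsideEigenvalue r = 0 := by
  obtain ⟨t, rfl⟩ := hr
  rw [burnsideEigenvalue, diffMoment_odd, mul_zero]

theorem burnsideEigenvalue_of_even {r : ℕ} (hr : Even r) :
    burnsideEigenvalue r = betaEV (r / 2) := by
  conv_lhs => rw [← Nat.two_mul_div_two_of_even hr, burnsideEigenvalue_two_mul]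

/-- exact formula for the chi-square distance from the one-ones state e_n. -/
theorem chiSq_exact_formula (n s : ℕ) (hn : 3 ≤ n) (hs : 1 ≤ s) :
    chiSq n s {n} =
      (∑ ℓ ∈ Finset.range (n + 1),
        if 2 ≤ ℓ ∧ Even ℓ then
          (((n - 1).choose ℓ : ℝ) - ℓ * ((n - 1).choose (ℓ - 1))) ^ 2 *
            ((2 * ℓ + 1) * ((ℓ.factorial : ℝ)) ^ 2 * (n + 1) /
              ∏ i ∈ Finset.Icc (-(ℓ : ℤ) + 1) ((ℓ : ℤ) + 1), ((n : ℝ) + (i : ℝ))) *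
            betaEV (ℓ / 2) ^ (2 * s)
        else 0) +
      (∑ ℓ ∈ Finset.range (n - 1),
        if Odd ℓ then
          ((2 + ℓ : ℝ) * ((n - 2).choose ℓ)) ^ 2 *
            ((ℓ + 1) * (2 * ℓ + 3) * ((ℓ.factorial : ℝ)) ^ 2 * ((n : ℝ) - 1) ^ 2 * (n + 1) /
              ((ℓ + 2) * ∏ i ∈ Finset.Icc (-(ℓ : ℤ) - 1) ((ℓ : ℤ) + 1), ((n : ℝ) + (i : ℝ)))) *
            betaEV ((1 + ℓ) / 2) ^ (2 * s)
        else 0) := by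
  have h2s : 2 * s ≠ 0 := by omega
  rw [chiSq_singleton (by omega) s, sum_range_succ', sum_range_succ' _ n]
  have hz : burnsideEigenvalue 0 ^ (2 * s) *
      ((hahnPoly 0 n 0).eval 1 ^ 2 * (n + 1) / hahnNorm 0 n 0) = 1 := by
    have h0 : burnsideEigenvalue 0 = 1 := by
      rw [← mul_zero 2, burnsideEigenvalue_two_mul]
      simp [betaEV]
    have hn1 : (n : ℝ) + 1 ≠ 0 := by positivity
    rw [h0, eval_hahnPoly_zero_one (by omega), hahnNorm, rodriguesConst]
    simp [hn1]
  rw [hz, add_sub_cancel_right, if_neg (by omega), add_zero]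
  congr 1
  · refine sum_congr rfl fun k hk => ?_
    have hkn : k + 1 ≤ n := mem_range.1 hk
    by_cases hev : Even (k + 1)
    · have h2 : 2 ≤ k + 1 := by
        obtain ⟨t, ht⟩ := hev
        omega
      rw [if_pos ⟨h2, hev⟩, burnsideEigenvalue_of_even hev, eval_hahnPoly_zero_one (by omega),
        hahnNorm_zero hkn, div_div_eq_mul_div]
      ring
    · rw [if_neg fun h => hev h.2, burnsideEigenvalue_of_odd (Nat.not_even_iff_odd.1 hev),
        zero_pow h2s, zero_mul]
  · refine sum_congr rfl fun ℓ hℓ => ?_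
    have hℓn : ℓ + 2 ≤ n := by
      have := mem_range.1 hℓ
      omega
    by_cases hodd : Odd ℓ
    · rw [if_pos hodd, burnsideEigenvalue_of_even hodd.add_one, eval_hahnPoly_one_one (by omega),
        hahnNorm_one hℓn, div_div_eq_mul_div, add_comm ℓ 1]
      ring
    · rw [if_neg hodd, burnsideEigenvalue_of_odd (Nat.not_odd_iff_even.1 hodd).add_one,
        zero_pow h2s, zero_mul]
end
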